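/- arXiv:2302.10122 — 2 statements merged into one kernel-verified Lean document; each statement's English description precedes it below -/
import Mathlib

section
/- For every 2π-periodic C² function f whose Fourier coefficients vanish for all |j| ≤ k−1, one has ‖f''‖_∞ ≥ (8k²/π²)·‖f‖_∞. -/
open Real MeasureTheory intervalIntegral

theorem summable_pow_natAbs {r : ℝ} (h0 : 0 ≤ r) (h1 : r < 1) :
    Summable fun n : ℤ => r ^ n.natAbs := by
  refine Summable.of_nat_of_neg ?_ ?_ <;> simpa using summable_geometric_of_lt_one h0 h1

/-- The Poisson kernel of the disc, written as a Fourier series, is nonnegative. -/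
theorem tsum_pow_natAbs_mul_cos_nonneg {r : ℝ} (h0 : 0 ≤ r) (h1 : r < 1) (t : ℝ) :
    0 ≤ ∑' n : ℤ, r ^ n.natAbs * cos (n * t) := by
  set z : ℂ := r * Complex.exp (t * Complex.I) with hz
  have hn : ‖z‖ = r := by
    rw [hz, norm_mul, Complex.norm_exp_ofReal_mul_I, Complex.norm_real, norm_of_nonneg h0, mul_one]
  have hre (n : ℕ) : (z ^ n).re = r ^ n * cos (n * t) := by
    have : z ^ n = ((r ^ n : ℝ) : ℂ) * Complex.exp ((n * t : ℝ) * Complex.I) := by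
      rw [hz, mul_pow, ← Complex.exp_nat_mul]
      push_cast
      ring_nf
    rw [this, Complex.re_ofReal_mul, Complex.exp_ofReal_mul_I_re]
  have hs : HasSum (fun n : ℕ => r ^ n * cos (n * t)) ((1 - z)⁻¹).re := by
    simpa only [hre] using
      Complex.hasSum_re (hasSum_geometric_of_norm_lt_one (ξ := z) (by rwa [hn]))
  have hs' : HasSum (fun n : ℤ => r ^ n.natAbs * cos (n * t))
      (((1 - z)⁻¹).re + ((1 - z)⁻¹).re - 1) := by
    have := HasSum.of_nat_of_neg (f := fun n : ℤ => r ^ n.natAbs * cos (n * t))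
      (by simpa using hs) (by simpa using hs)
    simpa using this
  rw [hs'.tsum_eq]
  have hpos : 0 < Complex.normSq (1 - z) := by
    rw [Complex.normSq_pos, sub_ne_zero]
    intro h
    rw [← h] at hn
    simp at hn
    linarith
  have hsq : z.re ^ 2 + z.im ^ 2 = r ^ 2 := by
    rw [← hn, Complex.sq_norm, Complex.normSq_apply]
    ring
  have : ((1 - z)⁻¹).re + ((1 - z)⁻¹).re - 1 = (1 - r ^ 2) / Complex.normSq (1 - z) := by
    rw [Complex.inv_re, eq_div_iff hpos.ne', sub_mul, add_mul, div_mul_cancel₀ _ hpos.ne',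
      Complex.normSq_apply, ← hsq]
    simp
    ring
  rw [this]
  exact div_nonneg (by nlinarith) hpos.le

theorem hasSum_intervalIntegral_mul {ι : Type*} [Countable ι] {w : ℝ → ℝ} (hw : Measurable w)
    {C : ℝ} (hC : ∀ t, |w t| ≤ C) {u : ι → ℝ → ℝ} (hu : ∀ i, Continuous (u i)) {b : ι → ℝ}
    (hb : Summable b) (hub : ∀ i t, |u i t| ≤ b i) {S : ℝ → ℝ} {x y : ℝ} (hxy : x ≤ y)
    (hS : ∀ t ∈ Set.Icc x y, HasSum (fun i => u i t) (S t)) :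
    HasSum (fun i => ∫ t in x..y, w t * u i t) (∫ t in x..y, w t * S t) := by
  refine intervalIntegral.hasSum_integral_of_dominated_convergence (fun i _ => C * b i)
    (fun i => (hw.mul (hu i).measurable).aestronglyMeasurable) (fun i => ?_) ?_
    intervalIntegrable_const ?_
  · refine .of_forall fun t _ => ?_
    rw [norm_mul]
    exact mul_le_mul (hC t) (hub i t) (abs_nonneg _) ((abs_nonneg _).trans (hC t))
  · exact .of_forall fun _ _ => hb.mul_left C
  · refine .of_forall fun t ht => (hS t ?_).mul_left (w t)
    rw [Set.uIoc_of_le hxy] at ht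
    exact Set.Ioc_subset_Icc_self ht

theorem intervalIntegrable_mul_of_bounded {w u : ℝ → ℝ} (hw : Measurable w)
    {C : ℝ} (hC : ∀ t, |w t| ≤ C) (hu : Continuous u) (x y : ℝ) :
    IntervalIntegrable (fun t => w t * u t) volume x y :=
  ⟨(hu.intervalIntegrable x y).1.bdd_mul (c := C) hw.aestronglyMeasurable (.of_forall hC),
    (hu.intervalIntegrable x y).2.bdd_mul (c := C) hw.aestronglyMeasurable (.of_forall hC)⟩

/-- Laplace averaging of a nonnegative two-sided power series. -/
theorem tsum_div_sq_nonneg {a : ℤ → ℝ} {C : ℝ} (hC : ∀ n, |a n| ≤ C) (h0 : a 0 = 0)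
    (h : ∀ r : ℝ, 0 < r → r < 1 → 0 ≤ ∑' n : ℤ, r ^ n.natAbs * a n) :
    0 ≤ ∑' n : ℤ, a n / (n : ℝ) ^ 2 := by
  set F : ℤ → ℝ → ℝ := fun n s => a n * (s * exp (-(|(n : ℝ)| * s)))
  have hint (n : ℤ) (hn : n ≠ 0) :
      ∫ s in Set.Ioi (0 : ℝ), s * exp (-(|(n : ℝ)| * s)) = 1 / (n : ℝ) ^ 2 := by
    have := Real.integral_rpow_mul_exp_neg_mul_Ioi (a := 2) (r := |(n : ℝ)|) two_pos
      (by positivity)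
    norm_num at this
    simpa using this
  have hI (n : ℤ) : IntegrableOn (F n) (Set.Ioi 0) := by
    by_cases hn : n = 0
    · simp [F, hn, h0]
    · refine Integrable.const_mul ?_ _
      by_contra hc
      have := hint n hn
      rw [integral_undef hc] at this
      have : (0 : ℝ) < 1 / (n : ℝ) ^ 2 := by positivity
      linarith
  have hval (c : ℤ → ℝ) (hc : c 0 = 0) (n : ℤ) :
      ∫ s in Set.Ioi (0 : ℝ), c n * (s * exp (-(|(n : ℝ)| * s))) = c n / (n : ℝ) ^ 2 := by
    rw [MeasureTheory.integral_const_mul]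
    by_cases hn : n = 0
    · simp [hn, hc]
    · rw [hint n hn, mul_one_div]
  have hnorm (n : ℤ) : ∫ s in Set.Ioi (0 : ℝ), ‖F n s‖ = |a n| / (n : ℝ) ^ 2 := by
    rw [← hval (fun n => |a n|) (by simp [h0]) n]
    refine setIntegral_congr_fun measurableSet_Ioi fun s hs => ?_
    have hs : 0 < s := hs
    simp only [F, norm_mul, norm_eq_abs, abs_of_pos hs, abs_of_pos (exp_pos _)]
  have hsum : Summable fun n : ℤ => ∫ s in Set.Ioi (0 : ℝ), ‖F n s‖ := by
    simp_rw [hnorm]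
    refine Summable.of_nonneg_of_le (fun n => by positivity) (fun n => ?_)
      ((Real.summable_one_div_int_pow.mpr one_lt_two).mul_left C)
    rw [mul_one_div]
    exact div_le_div_of_nonneg_right (hC n) (by positivity)
  have := hasSum_integral_of_summable_integral_norm hI hsum
  simp_rw [F, hval a h0] at this
  rw [this.tsum_eq]
  refine setIntegral_nonneg measurableSet_Ioi fun s hs => ?_
  have hs : 0 < s := hs
  have := h (exp (-s)) (exp_pos _) (by simpa using hs)
  refine (mul_nonneg hs.le this).trans_eq ?_
  rw [← tsum_mul_left]
  refine tsum_congr fun n => ?_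
  rw [← exp_nat_mul, Nat.cast_natAbs]
  push_cast
  ring_nf

theorem abs_integral_mul_cos_le {w : ℝ → ℝ} {C : ℝ} (hC : ∀ t, |w t| ≤ C) (n : ℤ) :
    |∫ t in (0 : ℝ)..2 * π, w t * cos (n * t)| ≤ C * |2 * π - 0| := by
  rw [← norm_eq_abs]
  refine intervalIntegral.norm_integral_le_of_norm_le_const fun t _ => ?_
  rw [norm_mul]
  exact (mul_le_mul (hC t) (abs_cos_le_one _) (abs_nonneg _)
    ((abs_nonneg _).trans (hC t))).trans_eq (mul_one C)

/-- If the cosine coefficients of `w` of order less than `k` vanish and `w` has the sign of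
`cos (k t)`, then its Poisson integral at the origin is nonnegative. -/
theorem tsum_pow_mul_integral_cos_nonneg {k : ℕ} {w : ℝ → ℝ} (hw : Measurable w) {C : ℝ}
    (hC : ∀ t, |w t| ≤ C)
    (hlow : ∀ n : ℤ, n.natAbs < k → ∫ t in (0 : ℝ)..2 * π, w t * cos (n * t) = 0)
    (hsign : ∀ t, 0 ≤ w t * cos (k * t)) {r : ℝ} (hr0 : 0 < r) (hr1 : r < 1) :
    0 ≤ ∑' n : ℤ, r ^ n.natAbs * ∫ t in (0 : ℝ)..2 * π, w t * cos (n * t) := by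
  set A : ℤ → ℝ := fun n => ∫ t in (0 : ℝ)..2 * π, w t * cos (n * t) with hA
  have hgeo := summable_pow_natAbs hr0.le hr1
  have hcos (t : ℝ) : Summable fun n : ℤ => r ^ n.natAbs * cos (n * t) := by
    refine hgeo.of_norm_bounded fun n => ?_
    rw [norm_mul, norm_of_nonneg (by positivity)]
    exact mul_le_of_le_one_right (by positivity) (abs_cos_le_one _)
  have hAsum (j : ℤ) : Summable fun n : ℤ => r ^ n.natAbs * A (n + j) := by
    refine (hgeo.mul_right (C * |2 * π - 0|)).of_norm_bounded fun n => ?_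
    rw [norm_mul, norm_of_nonneg (by positivity)]
    exact mul_le_mul_of_nonneg_left (abs_integral_mul_cos_le hC _) (by positivity)
  have key := hasSum_intervalIntegral_mul hw hC
    (u := fun (n : ℤ) t => cos (k * t) * (r ^ n.natAbs * cos (n * t)))
    (fun n => by fun_prop) hgeo (fun n t => ?_) two_pi_pos.le
    (fun t _ => (hcos t).hasSum.mul_left (cos (k * t)))
  swap
  · rw [abs_mul, abs_mul, abs_of_pos (by positivity : 0 < r ^ n.natAbs)]
    have h1 := abs_cos_le_one (k * t)
    have h2 := mul_le_of_le_one_right (by positivity : 0 ≤ r ^ n.natAbs) (abs_cos_le_one (n * t))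
    exact (mul_le_of_le_one_left (by positivity) h1).trans h2
  have hterm (n : ℤ) : ∫ t in (0 : ℝ)..2 * π, w t * (cos (k * t) * (r ^ n.natAbs * cos (n * t))) =
      (r ^ n.natAbs * A (n + k) + r ^ n.natAbs * A (n + -k)) / 2 := by
    rw [← mul_add, hA]
    simp only
    rw [← intervalIntegral.integral_add (intervalIntegrable_mul_of_bounded hw hC (by fun_prop) _ _)
      (intervalIntegrable_mul_of_bounded hw hC (by fun_prop) _ _),
      ← intervalIntegral.integral_const_mul, ← intervalIntegral.integral_div]
    refine intervalIntegral.integral_congr fun t _ => ?_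
    push_cast
    rw [add_mul, add_mul, cos_add, cos_add, neg_mul, cos_neg, sin_neg]
    ring
  simp_rw [hterm] at key
  have hshift (j : ℤ) : ∑' n : ℤ, r ^ n.natAbs * A (n + j) = ∑' n : ℤ, r ^ (n - j).natAbs * A n := by
    rw [← (Equiv.addRight j).tsum_eq (fun n : ℤ => r ^ (n - j).natAbs * A n)]
    simp
  have hshiftS (j : ℤ) : Summable fun n : ℤ => r ^ (n - j).natAbs * A n := by
    rw [← (Equiv.addRight j).summable_iff]
    simpa [Function.comp_def] using hAsum j
  have hk : (r ^ k + (r ^ k)⁻¹) / 2 * ∑' n : ℤ, r ^ n.natAbs * A n =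
      ∫ t in (0 : ℝ)..2 * π, w t * (cos (k * t) * ∑' n : ℤ, r ^ n.natAbs * cos (n * t)) := by
    rw [← key.tsum_eq, tsum_div_const, (hAsum k).tsum_add (hAsum _), hshift, hshift,
      ← (hshiftS _).tsum_add (hshiftS _), ← tsum_mul_left, ← tsum_div_const]
    refine tsum_congr fun n => ?_
    by_cases hn : n.natAbs < k
    · simp [hA, hlow n hn]
    · have hrk : (r ^ k)⁻¹ * r ^ n.natAbs = r ^ (n.natAbs - k) := by
        rw [inv_mul_eq_iff_eq_mul₀ (by positivity), ← pow_add]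
        congr 1
        omega
      have : r ^ (n - k).natAbs + r ^ (n - -k).natAbs =
          r ^ k * r ^ n.natAbs + (r ^ k)⁻¹ * r ^ n.natAbs := by
        rw [hrk, ← pow_add]
        rcases le_total 0 n with h | h
        · rw [add_comm]
          congr 2 <;> omega
        · congr 2 <;> omega
      linear_combination -(A n / 2) * this
  have hnn : 0 ≤ (r ^ k + (r ^ k)⁻¹) / 2 * ∑' n : ℤ, r ^ n.natAbs * A n := by
    rw [hk]
    refine intervalIntegral.integral_nonneg two_pi_pos.le fun t _ => ?_
    rw [← mul_assoc]
    exact mul_nonneg (hsign t) (tsum_pow_natAbs_mul_cos_nonneg hr0.le hr1 t)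
  exact nonneg_of_mul_nonneg_right hnn (by positivity)

theorem hasSum_one_div_int_sq_mul_cos {t : ℝ} (ht : t ∈ Set.Icc 0 (2 * π)) :
    HasSum (fun n : ℤ => 1 / (n : ℝ) ^ 2 * cos (n * t))
      ((3 * t ^ 2 - 6 * π * t + 2 * π ^ 2) / 6) := by
  have hx : t / (2 * π) ∈ Set.Icc (0 : ℝ) 1 :=
    ⟨div_nonneg ht.1 two_pi_pos.le, (div_le_one two_pi_pos).mpr ht.2⟩
  have h := hasSum_one_div_nat_pow_mul_cos one_ne_zero hx
  have hB : (Polynomial.bernoulli 2) = Polynomial.X ^ 2 - Polynomial.X + Polynomial.C (1 / 6) := by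
    simp [Polynomial.bernoulli, Finset.sum_range_succ, bernoulli_one, bernoulli_two,
      ← Polynomial.C_mul_X_pow_eq_monomial]
    have : (Polynomial.C (-1 / 2 : ℚ)) * 2 = -1 := by
      rw [← map_ofNat Polynomial.C 2, ← map_mul]
      norm_num
    linear_combination Polynomial.X * this
  have h' : HasSum (fun n : ℕ => 1 / (n : ℝ) ^ 2 * cos (n * t))
      ((3 * t ^ 2 - 6 * π * t + 2 * π ^ 2) / 12) := by
    convert h using 1
    · ext n
      congr 2
      field_simp
    · rw [mul_one, hB]
      simp [Nat.factorial]
      field_simp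
      ring
  have := HasSum.of_nat_of_neg (f := fun n : ℤ => 1 / (n : ℝ) ^ 2 * cos (n * t))
    (by simpa using h') (by simpa using h')
  rw [Int.cast_zero, zero_pow two_ne_zero, div_zero, zero_mul] at this
  have e : (3 * t ^ 2 - 6 * π * t + 2 * π ^ 2) / 6 =
      (3 * t ^ 2 - 6 * π * t + 2 * π ^ 2) / 12 + (3 * t ^ 2 - 6 * π * t + 2 * π ^ 2) / 12 - 0 := by
    ring
  rwa [e]

/-- The extremal kernel inequality: a function without cosine coefficients of order less than `k`
which has the sign of `cos (k t)` pairs nonnegatively with the second Bernoulli polynomial. -/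
theorem integral_mul_quadratic_nonneg {k : ℕ} (hk : 1 ≤ k) {w : ℝ → ℝ} (hw : Measurable w) {C : ℝ}
    (hC : ∀ t, |w t| ≤ C)
    (hlow : ∀ n : ℤ, n.natAbs < k → ∫ t in (0 : ℝ)..2 * π, w t * cos (n * t) = 0)
    (hsign : ∀ t, 0 ≤ w t * cos (k * t)) :
    0 ≤ ∫ t in (0 : ℝ)..2 * π, w t * ((3 * t ^ 2 - 6 * π * t + 2 * π ^ 2) / 6) := by
  have h := hasSum_intervalIntegral_mul hw hC
    (u := fun (n : ℤ) t => 1 / (n : ℝ) ^ 2 * cos (n * t))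
    (fun n => by fun_prop) (Real.summable_one_div_int_pow.mpr one_lt_two) (fun n t => ?_)
    two_pi_pos.le (fun t ht => hasSum_one_div_int_sq_mul_cos ht)
  swap
  · rw [abs_mul, abs_of_nonneg (by positivity : 0 ≤ 1 / (n : ℝ) ^ 2)]
    exact mul_le_of_le_one_right (by positivity) (abs_cos_le_one _)
  rw [← h.tsum_eq]
  convert tsum_div_sq_nonneg (abs_integral_mul_cos_le hC) (hlow 0 (by simp; omega))
    (fun r h0 h1 => tsum_pow_mul_integral_cos_nonneg hw hC hlow hsign h0 h1) using 3 with n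
  rw [← intervalIntegral.integral_div]
  congr 1
  ext t
  ring

theorem measurable_real_sign : Measurable Real.sign :=
  Measurable.ite measurableSet_Iio measurable_const
    (Measurable.ite measurableSet_Ioi measurable_const measurable_const)

theorem abs_real_sign_le_one (x : ℝ) : |Real.sign x| ≤ 1 := by
  rcases Real.sign_apply_eq x with h | h | h <;> simp [h]

theorem Function.Periodic.intervalIntegral_comp_add_right {F : ℝ → ℝ} {T : ℝ}
    (hF : Function.Periodic F T) (a : ℝ) :
    ∫ t in (0 : ℝ)..T, F (t + a) = ∫ t in (0 : ℝ)..T, F t := by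
  rw [intervalIntegral.integral_comp_add_right, zero_add, add_comm T a,
    hF.intervalIntegral_add_eq a 0, zero_add]

theorem integral_sign_cos_mul_cos_eq_zero {k : ℕ} (n : ℤ) (hn : n.natAbs < k) :
    ∫ t in (0 : ℝ)..2 * π, Real.sign (cos (k * t)) * cos (n * t) = 0 := by
  have hk : (0 : ℝ) < k := by exact_mod_cast (Nat.zero_le _).trans_lt hn
  have hm : Measurable fun t : ℝ => Real.sign (cos (k * t)) :=
    measurable_real_sign.comp (by fun_prop)
  have hb (t : ℝ) : |Real.sign (cos (k * t))| ≤ 1 := abs_real_sign_le_one _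
  set θ : ℝ := n * (π / k) with hθ
  have hsign (t : ℝ) : Real.sign (cos (k * (t + π / k))) = -Real.sign (cos (k * t)) := by
    rw [mul_add, mul_div_cancel₀ _ hk.ne', cos_add_pi, Real.sign_neg]
  have hper (t : ℝ) : cos (k * (t + 2 * π)) = cos (k * t) := by
    rw [mul_add, cos_add_nat_mul_two_pi]
  set c := ∫ t in (0 : ℝ)..2 * π, Real.sign (cos (k * t)) * cos (n * t) with hc
  set s := ∫ t in (0 : ℝ)..2 * π, Real.sign (cos (k * t)) * sin (n * t) with hs
  have hic : IntervalIntegrable (fun t => Real.sign (cos (k * t)) * cos (n * t)) volume 0 (2 * π) :=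
    intervalIntegrable_mul_of_bounded hm hb (by fun_prop) _ _
  have his : IntervalIntegrable (fun t => Real.sign (cos (k * t)) * sin (n * t)) volume 0 (2 * π) :=
    intervalIntegrable_mul_of_bounded hm hb (by fun_prop) _ _
  have h1 : c = s * sin θ - c * cos θ := by
    have hp : Function.Periodic (fun t => Real.sign (cos (k * t)) * cos (n * t)) (2 * π) :=
      fun t => by simp only [hper, mul_add (n : ℝ), cos_add_int_mul_two_pi]
    have hsh := hp.intervalIntegral_comp_add_right (π / k)
    rw [← hc] at hsh
    nth_rewrite 1 [← hsh]
    rw [hs, hc,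
      ← intervalIntegral.integral_mul_const, ← intervalIntegral.integral_mul_const,
      ← intervalIntegral.integral_sub (his.mul_const _) (hic.mul_const _)]
    refine intervalIntegral.integral_congr fun t _ => ?_
    simp only [hsign, mul_add (n : ℝ), cos_add, ← hθ]
    ring
  have h2 : s = s * -cos θ - c * sin θ := by
    have hp : Function.Periodic (fun t => Real.sign (cos (k * t)) * sin (n * t)) (2 * π) :=
      fun t => by simp only [hper, mul_add (n : ℝ), sin_add_int_mul_two_pi]
    have hsh := hp.intervalIntegral_comp_add_right (π / k)
    rw [← hs] at hsh
    nth_rewrite 1 [← hsh]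
    rw [hs, hc,
      ← intervalIntegral.integral_mul_const, ← intervalIntegral.integral_mul_const,
      ← intervalIntegral.integral_sub (his.mul_const _) (hic.mul_const _)]
    refine intervalIntegral.integral_congr fun t _ => ?_
    simp only [hsign, mul_add (n : ℝ), sin_add, ← hθ]
    ring
  have hθπ : |θ| < π := by
    rw [hθ, abs_mul, abs_of_pos (div_pos pi_pos hk), mul_div_assoc', div_lt_iff₀ hk, mul_comm π]
    refine mul_lt_mul_of_pos_right ?_ pi_pos
    rw [← Int.cast_abs, Int.abs_eq_natAbs]
    exact_mod_cast hn
  have hcos : 0 < 1 + cos θ := by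
    have := cos_lt_cos_of_nonneg_of_le_pi (abs_nonneg θ) le_rfl hθπ
    rw [cos_pi, cos_abs] at this
    linarith
  have h3 : (c ^ 2 + s ^ 2) * (1 + cos θ) = 0 := by
    linear_combination c * h1 + s * h2
  have h4 : c ^ 2 + s ^ 2 = 0 := (mul_eq_zero.mp h3).resolve_right hcos.ne'
  nlinarith [sq_nonneg c, sq_nonneg s]

theorem integral_sign_cos_mul_quadratic (α β γ : ℝ) :
    ∫ u in (0 : ℝ)..2 * π, Real.sign (cos u) * (α + β * u + γ * u ^ 2) = γ * π ^ 3 / 2 := by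
  have hi (x y : ℝ) : IntervalIntegrable
      (fun u => Real.sign (cos u) * (α + β * u + γ * u ^ 2)) volume x y :=
    intervalIntegrable_mul_of_bounded (measurable_real_sign.comp measurable_cos)
      (fun _ => abs_real_sign_le_one _) (by fun_prop) _ _
  have hq (x y : ℝ) : ∫ u in x..y, (α + β * u + γ * u ^ 2) =
      α * (y - x) + β * (y ^ 2 - x ^ 2) / 2 + γ * (y ^ 3 - x ^ 3) / 3 := by
    rw [intervalIntegral.integral_add (Continuous.intervalIntegrable (by fun_prop) _ _)
      (Continuous.intervalIntegrable (by fun_prop) _ _),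
      intervalIntegral.integral_add (Continuous.intervalIntegrable (by fun_prop) _ _)
      (Continuous.intervalIntegrable (by fun_prop) _ _),
      intervalIntegral.integral_const_mul β]
    simp
    ring
  have hconst {x y : ℝ} (hxy : x ≤ y) (ε : ℝ)
      (h : ∀ u ∈ Set.Ioo x y, Real.sign (cos u) = ε) :
      ∫ u in x..y, Real.sign (cos u) * (α + β * u + γ * u ^ 2) =
        ε * ∫ u in x..y, (α + β * u + γ * u ^ 2) := by
    rw [← intervalIntegral.integral_const_mul, intervalIntegral.integral_of_le hxy,
      intervalIntegral.integral_of_le hxy, integral_Ioc_eq_integral_Ioo,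
      integral_Ioc_eq_integral_Ioo]
    exact setIntegral_congr_fun measurableSet_Ioo fun u hu => by simp only [h u hu]
  have hπ := pi_pos
  rw [← intervalIntegral.integral_add_adjacent_intervals (hi 0 (π / 2)) (hi (π / 2) (2 * π)),
    ← intervalIntegral.integral_add_adjacent_intervals (hi (π / 2) (3 * π / 2))
      (hi (3 * π / 2) (2 * π)),
    hconst (by linarith) 1 fun u hu => Real.sign_of_pos
      (cos_pos_of_mem_Ioo ⟨by linarith [hu.1], hu.2⟩),
    hconst (by linarith) (-1) fun u hu => Real.sign_of_neg
      (cos_neg_of_pi_div_two_lt_of_lt hu.1 (by linarith [hu.2])),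
    hconst (by linarith) 1 fun u hu => Real.sign_of_pos ?_, hq, hq, hq]
  · ring
  · rw [← cos_sub_two_pi]
    exact cos_pos_of_mem_Ioo ⟨by linarith [hu.1], by linarith [hu.2]⟩

theorem integral_sign_cos_nat_mul_mul_quadratic {k : ℕ} (hk : 1 ≤ k) (α β γ : ℝ) :
    ∫ t in (0 : ℝ)..2 * π, Real.sign (cos (k * t)) * (α + β * t + γ * t ^ 2) =
      γ * π ^ 3 / (2 * k ^ 2) := by
  have hk0 : (k : ℝ) ≠ 0 := by positivity
  set G : ℝ → ℝ := fun u => Real.sign (cos u) * (α + β * (u / k) + γ * (u / k) ^ 2) with hG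
  have hi (x y : ℝ) : IntervalIntegrable G volume x y :=
    intervalIntegrable_mul_of_bounded (measurable_real_sign.comp measurable_cos)
      (fun _ => abs_real_sign_le_one _) (by fun_prop) _ _
  have hpiece (j : ℕ) :
      ∫ u in (j * (2 * π))..((j + 1 : ℕ) * (2 * π)), G u = γ / k ^ 2 * π ^ 3 / 2 := by
    have e : ((j + 1 : ℕ) : ℝ) * (2 * π) = 2 * π + j * (2 * π) := by push_cast; ring
    have e' : (j : ℝ) * (2 * π) = 0 + j * (2 * π) := by ring
    rw [e]
    nth_rewrite 1 [e']
    rw [← intervalIntegral.integral_comp_add_right, ← integral_sign_cos_mul_quadratic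
      (α + β * (j * (2 * π) / k) + γ * (j * (2 * π) / k) ^ 2)
      (β / k + 2 * γ * (j * (2 * π)) / k ^ 2)]
    refine intervalIntegral.integral_congr fun u _ => ?_
    simp only [hG, cos_add_nat_mul_two_pi]
    field_simp
    ring
  have hsum := intervalIntegral.sum_integral_adjacent_intervals (f := G) (μ := volume)
    (a := fun j : ℕ => (j : ℝ) * (2 * π)) (n := k) fun j _ => hi _ _
  simp only [hpiece, Finset.sum_const, Finset.card_range, nsmul_eq_mul, Nat.cast_zero,
    zero_mul] at hsum
  have hscale : ∫ t in (0 : ℝ)..2 * π, Real.sign (cos (k * t)) * (α + β * t + γ * t ^ 2) =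
      ∫ t in (0 : ℝ)..2 * π, G (k * t) := by
    refine intervalIntegral.integral_congr fun t _ => ?_
    simp only [hG, mul_div_cancel_left₀ _ hk0]
  rw [hscale, intervalIntegral.integral_comp_mul_left _ hk0, mul_zero, ← hsum, smul_eq_mul]
  field_simp

/-- Pointwise Bohr–Favard inequality at the origin. -/
theorem abs_apply_zero_le_of_integral_cos_eq_zero {k : ℕ} (hk : 1 ≤ k) {f : ℝ → ℝ}
    (hper : Function.Periodic f (2 * π)) (hreg : ContDiff ℝ 2 f) {M : ℝ}
    (hM : ∀ t, |deriv (deriv f) t| ≤ M)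
    (hlow : ∀ n : ℤ, n.natAbs < k → ∫ t in (0 : ℝ)..2 * π, f t * cos (n * t) = 0) :
    |f 0| ≤ M * π ^ 2 / (8 * k ^ 2) := by
  have hk0 : (k : ℝ) ≠ 0 := by positivity
  have hreg' : ContDiff ℝ 1 (deriv f) := hreg.deriv' (n := 1)
  have hf (t : ℝ) : HasDerivAt f (deriv f t) t :=
    (hreg.differentiable two_ne_zero t).hasDerivAt
  have hf' (t : ℝ) : HasDerivAt (deriv f) (deriv (deriv f) t) t :=
    (hreg'.differentiable one_ne_zero t).hasDerivAt
  have cf : Continuous f := hreg.continuous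
  have cg : Continuous (deriv (deriv f)) := hreg'.continuous_deriv le_rfl
  have hp0 : f (2 * π) = f 0 := by simpa using hper 0
  have hp1 : deriv f (2 * π) = deriv f 0 := by
    have := deriv_comp_add_const f (2 * π) 0
    rw [show (fun x => f (x + 2 * π)) = f from funext hper, zero_add] at this
    exact this.symm
  have hlow' (n : ℤ) (hn : n.natAbs < k) :
      ∫ t in (0 : ℝ)..2 * π, deriv (deriv f) t * cos (n * t) = 0 := by
    have h := intervalIntegral.integral_eq_sub_of_hasDerivAt (a := 0) (b := 2 * π)
      (f := fun t => deriv f t * cos (n * t) + n * (f t * sin (n * t)))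
      (f' := fun t => deriv (deriv f) t * cos (n * t) + (n : ℝ) ^ 2 * (f t * cos (n * t)))
      (fun t _ => ?_) (Continuous.intervalIntegrable (by fun_prop) _ _)
    · rw [intervalIntegral.integral_add (Continuous.intervalIntegrable (by fun_prop) _ _)
        (Continuous.intervalIntegrable (by fun_prop) _ _), intervalIntegral.integral_const_mul,
        hlow n hn] at h
      have hc : cos (n * (2 * π)) = 1 := cos_int_mul_two_pi n
      have hs : sin (n * (2 * π)) = 0 := by simpa using sin_add_int_mul_two_pi 0 n
      simpa [hc, hs, hp1] using h
    · have hl : HasDerivAt (fun t : ℝ => (n : ℝ) * t) n t := by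
        simpa using (hasDerivAt_id t).const_mul (n : ℝ)
      refine (((hf' t).mul hl.cos).add (((hf t).mul hl.sin).const_mul (n : ℝ))).congr_deriv ?_
      ring
  have hval : ∫ t in (0 : ℝ)..2 * π,
      deriv (deriv f) t * ((3 * t ^ 2 - 6 * π * t + 2 * π ^ 2) / 6) = -(2 * π * f 0) := by
    have h := intervalIntegral.integral_eq_sub_of_hasDerivAt (a := 0) (b := 2 * π)
      (f := fun t => deriv f t * ((3 * t ^ 2 - 6 * π * t + 2 * π ^ 2) / 6) - f t * (t - π))
      (f' := fun t => deriv (deriv f) t * ((3 * t ^ 2 - 6 * π * t + 2 * π ^ 2) / 6) - f t)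
      (fun t _ => ?_) (Continuous.intervalIntegrable (by fun_prop) _ _)
    · have h0 : ∫ t in (0 : ℝ)..2 * π, f t = 0 := by
        simpa using hlow 0 (by simp; omega)
      rw [intervalIntegral.integral_sub (Continuous.intervalIntegrable (by fun_prop) _ _)
        (Continuous.intervalIntegrable (by fun_prop) _ _), h0, hp0, hp1] at h
      linear_combination h
    · have hl : HasDerivAt (fun t : ℝ => t - π) 1 t := (hasDerivAt_id t).sub_const π
      have hq : HasDerivAt (fun t : ℝ => (3 * t ^ 2 - 6 * π * t + 2 * π ^ 2) / 6) (t - π) t := by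
        refine ((((((hasDerivAt_id t).pow 2).const_mul 3).sub
          ((hasDerivAt_id t).const_mul (6 * π))).add_const (2 * π ^ 2)).div_const 6).congr_deriv ?_
        simp
        ring
      refine (((hf' t).mul hq).sub ((hf t).mul hl)).congr_deriv ?_
      ring
  have hms : Measurable fun t : ℝ => Real.sign (cos (k * t)) :=
    measurable_real_sign.comp (by fun_prop)
  have hbs (t : ℝ) : |Real.sign (cos (k * t))| ≤ 1 := abs_real_sign_le_one _
  have hM0 : 0 ≤ M := (abs_nonneg _).trans (hM 0)
  have hσ : ∫ t in (0 : ℝ)..2 * π,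
      Real.sign (cos (k * t)) * ((3 * t ^ 2 - 6 * π * t + 2 * π ^ 2) / 6) =
        π ^ 3 / (4 * k ^ 2) := by
    have := integral_sign_cos_nat_mul_mul_quadratic hk (π ^ 2 / 3) (-π) (1 / 2)
    convert this using 1
    · refine intervalIntegral.integral_congr fun t _ => ?_
      ring
    · field_simp
      norm_num
  have main (ε : ℝ) (hε : |ε| = 1) : 0 ≤ M * (π ^ 3 / (4 * k ^ 2)) + ε * -(2 * π * f 0) := by
    have hsplit {u : ℝ → ℝ} (hu : Continuous u) :
        ∫ t in (0 : ℝ)..2 * π, (M * Real.sign (cos (k * t)) + ε * deriv (deriv f) t) * u t =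
          M * (∫ t in (0 : ℝ)..2 * π, Real.sign (cos (k * t)) * u t) +
            ε * ∫ t in (0 : ℝ)..2 * π, deriv (deriv f) t * u t := by
      rw [← intervalIntegral.integral_const_mul, ← intervalIntegral.integral_const_mul,
        ← intervalIntegral.integral_add
          ((intervalIntegrable_mul_of_bounded hms hbs hu _ _).const_mul _)
          (Continuous.intervalIntegrable (by fun_prop) _ _)]
      refine intervalIntegral.integral_congr fun t _ => ?_
      ring
    have h := integral_mul_quadratic_nonneg hk (C := M * 1 + 1 * M)
      (w := fun t => M * Real.sign (cos (k * t)) + ε * deriv (deriv f) t)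
      ((hms.const_mul M).add (cg.measurable.const_mul ε)) (fun t => ?_) (fun n hn => ?_)
      (fun t => ?_)
    · rwa [hsplit (by fun_prop), hσ, hval] at h
    · refine (abs_add_le _ _).trans (add_le_add ?_ ?_)
      · rw [abs_mul, abs_of_nonneg hM0]
        exact mul_le_mul_of_nonneg_left (hbs t) hM0
      · rw [abs_mul, hε]
        exact mul_le_mul_of_nonneg_left (hM t) zero_le_one
    · rw [hsplit (by fun_prop), integral_sign_cos_mul_cos_eq_zero n hn, hlow' n hn]
      simp
    · have hs : Real.sign (cos (k * t)) * cos (k * t) = |cos (k * t)| := by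
        rcases lt_trichotomy (cos (k * t)) 0 with h | h | h
        · rw [Real.sign_of_neg h, abs_of_neg h, neg_one_mul]
        · simp [h]
        · rw [Real.sign_of_pos h, abs_of_pos h, one_mul]
      have hb : |ε * deriv (deriv f) t * cos (k * t)| ≤ M * |cos (k * t)| := by
        rw [abs_mul, abs_mul, hε, one_mul]
        exact mul_le_mul_of_nonneg_right (hM t) (abs_nonneg _)
      have := neg_abs_le (ε * deriv (deriv f) t * cos (k * t))
      rw [add_mul, mul_assoc, hs]
      linarith
  have e : M * (π ^ 3 / (4 * k ^ 2)) = 2 * π * (M * π ^ 2 / (8 * k ^ 2)) := by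
    field_simp
    ring
  have h1 := main 1 (by simp)
  have h2 := main (-1) (by simp)
  rw [e] at h1 h2
  rw [abs_le]
  constructor <;> refine le_of_mul_le_mul_left ?_ two_pi_pos <;> linarith

/-- **Reverse Bernstein inequality, second derivative.**
For every 2π-periodic C² function `f` whose Fourier coefficients vanish for all
`|j| ≤ k − 1`, one has `‖f''‖_∞ ≥ (8k²/π²)·‖f‖_∞`. -/
theorem reverse_bernstein_second_derivative
    (k : ℕ) (hk : 1 ≤ k) (f : ℝ → ℝ)
    (hper : Function.Periodic f (2 * π))
    (hreg : ContDiff ℝ 2 f)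
    (horth : ∀ j : ℤ, |j| ≤ (k : ℤ) - 1 →
      (∫ x in (0:ℝ)..(2 * π), (f x : ℂ) * Complex.exp (-Complex.I * j * x)) = 0) :
    (8 * k ^ 2 / π ^ 2) * (⨆ x : ℝ, |f x|) ≤ ⨆ x : ℝ, |deriv (deriv f) x| := by
  have hk0 : (0 : ℝ) < k := by exact_mod_cast hk
  have cf : Continuous f := hreg.continuous
  have hcs (j : ℤ) (hj : j.natAbs < k) :
      (∫ t in (0 : ℝ)..2 * π, f t * cos (j * t)) = 0 ∧
        (∫ t in (0 : ℝ)..2 * π, f t * sin (j * t)) = 0 := by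
    have h := horth j (by rw [Int.abs_eq_natAbs]; omega)
    have e (x : ℝ) : (f x : ℂ) * Complex.exp (-Complex.I * j * x) =
        ((f x * cos (j * x) : ℝ) : ℂ) - Complex.I * ((f x * sin (j * x) : ℝ) : ℂ) := by
      rw [show -Complex.I * j * x = ((-(j * x) : ℝ) : ℂ) * Complex.I by push_cast; ring,
        Complex.exp_mul_I, ← Complex.ofReal_cos, ← Complex.ofReal_sin, cos_neg, sin_neg]
      push_cast
      ring
    simp_rw [e] at h
    rw [intervalIntegral.integral_sub (Continuous.intervalIntegrable (by fun_prop) _ _)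
      (Continuous.intervalIntegrable (by fun_prop) _ _), intervalIntegral.integral_const_mul,
      intervalIntegral.integral_ofReal, intervalIntegral.integral_ofReal] at h
    have hre := congrArg Complex.re h
    have him := congrArg Complex.im h
    simp only [Complex.sub_re, Complex.sub_im, Complex.mul_re, Complex.mul_im, Complex.I_re,
      Complex.I_im, Complex.ofReal_re, Complex.ofReal_im, Complex.zero_re, Complex.zero_im] at hre him
    constructor <;> linarith
  have hshift (x : ℝ) : deriv (fun t => f (t + x)) = fun t => deriv f (t + x) :=
    funext fun t => deriv_comp_add_const f x t
  have hdd (x : ℝ) : deriv (deriv fun t => f (t + x)) = fun t => deriv (deriv f) (t + x) := by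
    rw [hshift]
    exact funext fun t => deriv_comp_add_const (deriv f) x t
  have hbdd : BddAbove (Set.range fun x => |deriv (deriv f) x|) := by
    have hp : Function.Periodic (fun x => |deriv (deriv f) x|) (2 * π) := fun x => by
      have := congrFun (hdd (2 * π)) x
      rw [show (fun t => f (t + 2 * π)) = f from funext hper] at this
      simp only [this]
    have hc : Continuous (deriv (deriv f)) := (hreg.deriv' (n := 1)).continuous_deriv le_rfl
    exact (hp.isBounded_of_continuous two_pi_pos.ne' hc.abs).bddAbove
  set M := ⨆ x : ℝ, |deriv (deriv f) x|
  have hpt (x : ℝ) : |f x| ≤ M * π ^ 2 / (8 * k ^ 2) := by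
    have h := abs_apply_zero_le_of_integral_cos_eq_zero hk (f := fun t => f (t + x)) (M := M)
      (fun t => by simp only [add_right_comm t (2 * π) x, hper _])
      (hreg.comp (contDiff_id.add contDiff_const))
      (fun t => by rw [hdd]; exact le_ciSup hbdd (t + x)) (fun n hn => ?_)
    · simpa using h
    · obtain ⟨h1, h2⟩ := hcs n hn
      have hp : Function.Periodic (fun t => f t * cos (n * (t - x))) (2 * π) := fun t => by
        simp only [hper t, add_sub_right_comm, mul_add, cos_add_int_mul_two_pi]
      have h3 := hp.intervalIntegral_comp_add_right x
      simp only [add_sub_cancel_right] at h3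
      rw [h3]
      have e (t : ℝ) : f t * cos (n * (t - x)) =
          f t * cos (n * t) * cos (n * x) + f t * sin (n * t) * sin (n * x) := by
        rw [mul_sub, cos_sub]
        ring
      simp_rw [e]
      rw [intervalIntegral.integral_add (Continuous.intervalIntegrable (by fun_prop) _ _)
        (Continuous.intervalIntegrable (by fun_prop) _ _), intervalIntegral.integral_mul_const,
        intervalIntegral.integral_mul_const, h1, h2, zero_mul, zero_mul, add_zero]
  calc (8 * k ^ 2 / π ^ 2) * (⨆ x : ℝ, |f x|)
      ≤ (8 * k ^ 2 / π ^ 2) * (M * π ^ 2 / (8 * k ^ 2)) :=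
        mul_le_mul_of_nonneg_left (ciSup_le hpt) (by positivity)
    _ = M := by
        field_simp
end

section
/- For every 2π-periodic function f of class C^{m} whose Fourier coefficients vanish for all |j| ≤ k−1, one has ‖f^{(m)}‖_∞ ≥ C_{k,m}·‖f‖_∞ where C_{k,m} = 1/‖I^{m−1}c_k‖_∞, with I the zero-mean primitive operator and c_k the triangular cosine of period 2π/k. Moreover the function I^{m-1}c_k attains equality, so C_{k,m} is optimal. -/
open Real MeasureTheory intervalIntegral

/-- The triangular cosine `c(x) = π/2 − d(x,0)`, where `d` is the angular
distance on `ℝ/2πℤ`. -/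
noncomputable def tri (x : ℝ) : ℝ := π / 2 - |x - 2 * π * round (x / (2 * π))|

lemma abs_sub_round_two_pi_le (x : ℝ) (l : ℤ) :
    |x - 2 * π * round (x / (2 * π))| ≤ |x - 2 * π * l| := by
  have h := mul_le_mul_of_nonneg_left (round_le (x / (2 * π)) l) Real.two_pi_pos.le
  have key : ∀ n : ℤ, 2 * π * |x / (2 * π) - n| = |x - 2 * π * n| := fun n => by
    rw [← abs_of_pos Real.two_pi_pos, ← abs_mul, abs_of_pos Real.two_pi_pos, mul_sub,
      mul_div_cancel₀ _ Real.two_pi_pos.ne']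
  rwa [key, key] at h

lemma tri_eq_of_abs_sub_le {x : ℝ} {l : ℤ} (h : |x - 2 * π * l| ≤ π) :
    tri x = π / 2 - |x - 2 * π * l| := by
  unfold tri
  congr 1
  refine le_antisymm (abs_sub_round_two_pi_le x l) ?_
  rcases eq_or_ne (round (x / (2 * π))) l with hr | hr
  · rw [hr]
  · set r := round (x / (2 * π))
    have h1 : (1 : ℝ) ≤ |(r : ℝ) - l| := by
      exact_mod_cast Int.one_le_abs (sub_ne_zero.mpr hr)
    have h2 : 2 * π * |(r : ℝ) - l| ≤ |x - 2 * π * l| + |x - 2 * π * r| := by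
      rw [← abs_of_pos Real.two_pi_pos, ← abs_mul, abs_of_pos Real.two_pi_pos]
      calc |2 * π * ((r : ℝ) - l)| = |(x - 2 * π * l) - (x - 2 * π * r)| := by ring_nf
        _ ≤ _ := abs_sub _ _
    nlinarith [Real.pi_pos]

lemma exists_abs_sub_two_pi_le (x : ℝ) : ∃ l : ℤ, |x - 2 * π * l| ≤ π := by
  refine ⟨round (x / (2 * π)), ?_⟩
  have h := mul_le_mul_of_nonneg_left (abs_sub_round (x / (2 * π))) Real.two_pi_pos.le
  rw [← abs_of_pos Real.two_pi_pos, ← abs_mul, abs_of_pos Real.two_pi_pos, mul_sub,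
    mul_div_cancel₀ _ Real.two_pi_pos.ne'] at h
  linarith

lemma tri_sub_le (x y : ℝ) : tri x - tri y ≤ |x - y| := by
  have h := abs_sub_round_two_pi_le y (round (x / (2 * π)))
  have h2 := abs_sub_abs_le_abs_sub (y - 2 * π * round (x / (2 * π)))
    (x - 2 * π * round (x / (2 * π)))
  rw [sub_sub_sub_cancel_right, abs_sub_comm y x] at h2
  unfold tri
  linarith

lemma abs_tri_sub_le (x y : ℝ) : |tri x - tri y| ≤ |x - y| :=
  abs_le'.mpr ⟨tri_sub_le x y, by rw [neg_sub, abs_sub_comm]; exact tri_sub_le y x⟩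

lemma continuous_tri : Continuous tri := by
  have h : LipschitzWith 1 tri := LipschitzWith.of_dist_le_mul fun x y => by
    simpa [Real.dist_eq] using abs_tri_sub_le x y
  exact h.continuous

lemma tri_antiperiodic : Function.Antiperiodic tri π := by
  intro x
  obtain ⟨l, hl⟩ := exists_abs_sub_two_pi_le x
  have hl' := abs_le.mp hl
  rw [tri_eq_of_abs_sub_le hl]
  rcases le_total (x - 2 * π * l) 0 with h | h
  · have h1 : |x + π - 2 * π * l| = x + π - 2 * π * l := abs_of_nonneg (by linarith)
    rw [tri_eq_of_abs_sub_le (l := l) (by rw [h1]; linarith), h1, abs_of_nonpos h]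
    ring
  · have h1 : |x + π - 2 * π * (l + 1 : ℤ)| = -(x + π - 2 * π * (l + 1 : ℤ)) :=
      abs_of_nonpos (by push_cast; linarith)
    rw [tri_eq_of_abs_sub_le (l := l + 1) (by rw [h1]; push_cast; linarith), h1, abs_of_nonneg h]
    push_cast
    ring

lemma abs_tri_sub_eq {j : ℤ} {u v : ℝ} (hu : u ∈ Set.Icc (j * π) ((j + 1) * π))
    (hv : v ∈ Set.Icc (j * π) ((j + 1) * π)) : |tri u - tri v| = |u - v| := by
  obtain ⟨hu1, hu2⟩ := hu
  obtain ⟨hv1, hv2⟩ := hv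
  rcases Int.even_or_odd' j with ⟨l, rfl | rfl⟩
  · push_cast at *
    have key : ∀ w : ℝ, 2 * l * π ≤ w → w ≤ (2 * l + 1) * π →
        tri w = π / 2 - (w - 2 * π * l) := by
      intro w h1 h2
      have h3 : |w - 2 * π * l| = w - 2 * π * l := abs_of_nonneg (by linarith)
      rw [tri_eq_of_abs_sub_le (l := l) (by rw [h3]; linarith), h3]
    rw [key u hu1 hu2, key v hv1 hv2, abs_sub_comm u v]
    ring_nf
  · push_cast at *
    have key : ∀ w : ℝ, (2 * l + 1) * π ≤ w → w ≤ (2 * l + 1 + 1) * π →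
        tri w = π / 2 + (w - 2 * π * (l + 1)) := by
      intro w h1 h2
      have h3 : |w - 2 * π * (l + 1 : ℤ)| = -(w - 2 * π * (l + 1 : ℤ)) :=
        abs_of_nonpos (by push_cast; linarith)
      rw [tri_eq_of_abs_sub_le (l := l + 1) (by rw [h3]; push_cast; linarith), h3]
      push_cast
      ring
    rw [key u hu1 hu2, key v hv1 hv2]
    ring_nf

lemma tri_zero : tri 0 = π / 2 := by
  simp [tri]

lemma abs_tri_le (x : ℝ) : |tri x| ≤ π / 2 := by
  obtain ⟨l, hl⟩ := exists_abs_sub_two_pi_le x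
  rw [tri_eq_of_abs_sub_le hl]
  exact abs_le.mpr ⟨by linarith, by linarith [abs_nonneg (x - 2 * π * l)]⟩

lemma exists_finset_of_zeros_card_le {P : ℝ → Prop} {n : ℕ}
    (h : ∀ Z : Finset ℝ, (∀ x, P x ↔ x ∈ Z) → n ≤ Z.card) :
    ∃ Z : Finset ℝ, Z.card = n ∧ ∀ x ∈ Z, P x := by
  by_cases hfin : {x | P x}.Finite
  · have hmem : ∀ x, P x ↔ x ∈ hfin.toFinset := fun x => by simp
    obtain ⟨t, ht, hcard⟩ := Finset.exists_subset_card_eq (h _ hmem)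
    exact ⟨t, hcard, fun x hx => (hmem x).mpr (ht hx)⟩
  · obtain ⟨t, ht, hcard⟩ := Set.Infinite.exists_subset_card_eq hfin n
    exact ⟨t, hcard, fun x hx => ht hx⟩

/-- Rolle theorem for a finite set of zeros. -/
lemma exists_finset_zeros_deriv {g g' : ℝ → ℝ} (hg : ∀ x, HasDerivAt g (g' x) x)
    {a b : ℝ} {Z : Finset ℝ} (hZ : ∀ x ∈ Z, x ∈ Set.Icc a b ∧ g x = 0) {n : ℕ}
    (hn : n + 1 ≤ Z.card) :
    ∃ W : Finset ℝ, W.card = n ∧ ∀ x ∈ W, x ∈ Set.Ioo a b ∧ g' x = 0 := by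
  refine exists_finset_of_zeros_card_le fun T hT => ?_
  have h := Finset.card_le_of_interleaved (s := Z) (t := T) fun x hx y hy hxy _ => ?_
  · omega
  · obtain ⟨c, hc, hc'⟩ := exists_hasDerivAt_eq_zero hxy
      (fun z _ => (hg z).continuousAt.continuousWithinAt) ((hZ x hx).2.trans (hZ y hy).2.symm)
      (fun z _ => hg z)
    refine ⟨c, (hT c).mp ⟨⟨?_, ?_⟩, hc'⟩, hc.1, hc.2⟩
    · exact (hZ x hx).1.1.trans_lt hc.1
    · exact hc.2.trans_le (hZ y hy).1.2

/-- Rolle theorem on the circle. -/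
lemma exists_finset_zeros_deriv_of_periodic {g g' : ℝ → ℝ} (hg : ∀ x, HasDerivAt g (g' x) x)
    {T : ℝ} (hT : 0 < T) (hper : Function.Periodic g T) {n : ℕ}
    (h : ∃ a, ∃ Z : Finset ℝ, Z.card = n ∧ ∀ x ∈ Z, x ∈ Set.Ico a (a + T) ∧ g x = 0) :
    ∃ a, ∃ Z : Finset ℝ, Z.card = n ∧ ∀ x ∈ Z, x ∈ Set.Ico a (a + T) ∧ g' x = 0 := by
  obtain ⟨a, Z, hcard, hZ⟩ := h
  rcases Z.eq_empty_or_nonempty with rfl | hne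
  · exact ⟨a, ∅, hcard, by simp⟩
  set b := Z.min' hne
  have hb : b ∈ Z := Z.min'_mem hne
  have hlt : ∀ x ∈ Z, x < b + T := fun x hx =>
    (hZ x hx).1.2.trans_le (by linarith [(hZ b hb).1.1])
  have hnot : b + T ∉ Z := fun hmem => lt_irrefl _ (hlt _ hmem)
  obtain ⟨W, hW, hW'⟩ := exists_finset_zeros_deriv hg (a := b) (b := b + T)
    (Z := insert (b + T) Z) (n := n) (by
      intro x hx
      rcases Finset.mem_insert.mp hx with rfl | hx
      · exact ⟨⟨by linarith, le_rfl⟩, (hper b).trans (hZ b hb).2⟩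
      · exact ⟨⟨Z.min'_le x hx, (hlt x hx).le⟩, (hZ x hx).2⟩)
    (by rw [Finset.card_insert_of_notMem hnot, hcard])
  exact ⟨b, W, hW, fun x hx => ⟨⟨(hW' x hx).1.1.le, (hW' x hx).1.2⟩, (hW' x hx).2⟩⟩

/-- A continuous function with finitely many zeros on an interval has the sign pattern of a
product of factors vanishing at some of these zeros. -/
lemma exists_subset_sign_prod {s : ℝ → ℝ} {a b : ℝ}
    (hspos : ∀ y, 0 < y → y < b - a → 0 < s y) (hsneg : ∀ y, y < 0 → a - b < y → s y < 0)
    {h : ℝ → ℝ} (hc : Continuous h) (Z : Finset ℝ) :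
    ∀ c ≤ b, (∀ x ∈ Z, x ∈ Set.Ioo a c ∧ h x = 0) → (∀ x ∈ Set.Ioo a c, h x = 0 → x ∈ Z) →
    ∃ S ⊆ Z, ∃ σ : ℝ, σ ≠ 0 ∧ ∀ x ∈ Set.Ioo a c, 0 ≤ σ * h x * ∏ z ∈ S, s (x - z) := by
  have hsign : ∀ u v, (∀ x ∈ Set.Ioo u v, h x ≠ 0) →
      ∃ τ : ℝ, (τ = 1 ∨ τ = -1) ∧ ∀ x ∈ Set.Ioo u v, 0 ≤ τ * h x := by
    intro u v hne
    by_cases hpos : ∀ x ∈ Set.Ioo u v, 0 ≤ h x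
    · exact ⟨1, Or.inl rfl, fun x hx => by simpa using hpos x hx⟩
    · push Not at hpos
      obtain ⟨y, hy, hy0⟩ := hpos
      refine ⟨-1, Or.inr rfl, fun x hx => ?_⟩
      by_contra! hx0
      have hx0' : 0 < h x := by linarith
      obtain ⟨z, hz, hz0⟩ := (isPreconnected_Ioo.intermediate_value hy hx hc.continuousOn)
        (show (0 : ℝ) ∈ Set.Icc (h y) (h x) from ⟨hy0.le, hx0'.le⟩)
      exact hne z hz hz0
  suffices H : ∀ c ≤ b, (∀ x ∈ Z, x ∈ Set.Ioo a c ∧ h x = 0) → (∀ x ∈ Set.Ioo a c, h x = 0 → x ∈ Z) →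
      ∃ S ⊆ Z, ∃ σ : ℝ, (σ = 1 ∨ σ = -1) ∧
        ∀ x ∈ Set.Ioo a c, 0 ≤ σ * h x * ∏ z ∈ S, s (x - z) by
    intro c hcb h1 h2
    obtain ⟨S, hS, σ, hσ, h3⟩ := H c hcb h1 h2
    exact ⟨S, hS, σ, by rcases hσ with rfl | rfl <;> norm_num, h3⟩
  induction Z using Finset.induction_on_max with
  | empty =>
    intro c _ _ h2
    obtain ⟨τ, hτ, hτ'⟩ := hsign a c fun x hx hx0 => by simpa using h2 x hx hx0
    exact ⟨∅, le_rfl, τ, hτ, by simpa using hτ'⟩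
  | insert z Z hmax ih =>
    intro c hcb h1 h2
    obtain ⟨hz, hz0⟩ := h1 z (Finset.mem_insert_self z Z)
    obtain ⟨S, hS, σ, hσ, h3⟩ := ih z (hz.2.le.trans hcb)
      (fun x hx => ⟨⟨(h1 x (Finset.mem_insert_of_mem hx)).1.1, hmax x hx⟩,
        (h1 x (Finset.mem_insert_of_mem hx)).2⟩)
      (fun x hx hx0 => (Finset.mem_insert.mp (h2 x ⟨hx.1, hx.2.trans hz.2⟩ hx0)).resolve_left
        hx.2.ne)
    obtain ⟨τ, hτ, hτ'⟩ := hsign z c fun x hx hx0 => by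
      rcases Finset.mem_insert.mp (h2 x ⟨hz.1.trans hx.1, hx.2⟩ hx0) with rfl | hxZ
      · exact lt_irrefl _ hx.1
      · exact lt_asymm hx.1 (hmax x hxZ)
    have hprod : ∀ x ∈ Set.Ioo z c, 0 ≤ ∏ w ∈ S, s (x - w) := fun x hx =>
      Finset.prod_nonneg fun w hw => by
        have hw' := (h1 w (Finset.mem_insert_of_mem (hS hw))).1
        exact (hspos _ (by linarith [hmax w (hS hw), hx.1])
          (by linarith [hw'.1, hx.2])).le
    by_cases hτσ : τ = σ
    · subst hτσ
      refine ⟨S, hS.trans (Finset.subset_insert z Z), τ, hτ, fun x hx => ?_⟩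
      rcases lt_trichotomy x z with hxz | rfl | hxz
      · exact h3 x ⟨hx.1, hxz⟩
      · simp [hz0]
      · exact mul_nonneg (hτ' x ⟨hxz, hx.2⟩) (hprod x ⟨hxz, hx.2⟩)
    · have hneg : τ = -σ := by
        rcases hτ with rfl | rfl <;> rcases hσ with rfl | rfl <;> simp_all
      have hzS : z ∉ S := fun hmem => lt_irrefl _ (hmax z (hS hmem))
      refine ⟨insert z S, Finset.insert_subset_insert z hS, τ, hτ, fun x hx => ?_⟩
      rw [Finset.prod_insert hzS]
      rcases lt_trichotomy x z with hxz | rfl | hxz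
      · have h4 := h3 x ⟨hx.1, hxz⟩
        have h5 := hsneg (x - z) (by linarith) (by linarith [hx.1, hz.2])
        rw [hneg]
        nlinarith [mul_nonneg h4 (neg_nonneg.mpr h5.le)]
      · simp [hz0]
      · have h4 := hprod x ⟨hxz, hx.2⟩
        have h5 := hspos (x - z) (by linarith) (by linarith [hx.2, hz.1])
        exact mul_nonneg (hτ' x ⟨hxz, hx.2⟩) (mul_nonneg h5.le h4)

/-- A product of `2 p` half-angle sines is a trigonometric polynomial of degree at most `p`. -/
lemma exists_prod_sin_eq_sum {p : ℕ} {S : Finset ℝ} (hS : S.card = 2 * p) :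
    ∃ c : ℕ → ℂ, ∀ x : ℝ, ((∏ z ∈ S, Real.sin ((x - z) / 2) : ℝ) : ℂ) =
      ∑ l ∈ Finset.range (2 * p + 1),
        c l * Complex.exp (-Complex.I * ((p : ℤ) - l : ℤ) * x) := by
  let α : ℝ → ℂ := fun z => Complex.exp (-(z / 2 * Complex.I)) / (2 * Complex.I)
  let β : ℝ → ℂ := fun z => -Complex.exp (z / 2 * Complex.I) / (2 * Complex.I)
  let P : Polynomial ℂ := ∏ z ∈ S, (Polynomial.C (α z) * Polynomial.X + Polynomial.C (β z))
  have hdeg : P.natDegree < 2 * p + 1 := by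
    refine Nat.lt_succ_of_le ((Polynomial.natDegree_prod_le _ _).trans ?_)
    refine (Finset.sum_le_card_nsmul _ _ 1 fun z _ => Polynomial.natDegree_linear_le).trans ?_
    simp [hS]
  have hsin : ∀ x z : ℝ, ((Real.sin ((x - z) / 2) : ℝ) : ℂ) =
      Complex.exp (-(x / 2 * Complex.I)) * (α z * Complex.exp (x * Complex.I) + β z) := by
    intro x z
    have e1 : Complex.exp (x * Complex.I) =
        Complex.exp (x / 2 * Complex.I) * Complex.exp (x / 2 * Complex.I) := by
      rw [← Complex.exp_add]; ring_nf
    have e2 : Complex.exp (-(x / 2 * Complex.I)) * Complex.exp (x / 2 * Complex.I) = 1 := by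
      rw [← Complex.exp_add]; simp
    have e3 : Complex.exp ((((x - z) / 2 : ℝ) : ℂ) * Complex.I) =
        Complex.exp (x / 2 * Complex.I) * Complex.exp (-(z / 2 * Complex.I)) := by
      rw [← Complex.exp_add]; push_cast; ring_nf
    have e4 : Complex.exp (-(((x - z) / 2 : ℝ) : ℂ) * Complex.I) =
        Complex.exp (-(x / 2 * Complex.I)) * Complex.exp (z / 2 * Complex.I) := by
      rw [← Complex.exp_add]; push_cast; ring_nf
    rw [Complex.ofReal_sin, Complex.sin, e3, e4, e1]
    simp only [α, β]
    have hI : Complex.I ≠ 0 := Complex.I_ne_zero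
    generalize Complex.exp (-(x / 2 * Complex.I)) = u at *
    generalize Complex.exp (x / 2 * Complex.I) = v at *
    generalize Complex.exp (-(z / 2 * Complex.I)) = w at *
    generalize Complex.exp (z / 2 * Complex.I) = y at *
    field_simp
    rw [Complex.I_sq]
    linear_combination -(v * w) * e2
  refine ⟨P.coeff, fun x => ?_⟩
  have h1 : ((∏ z ∈ S, Real.sin ((x - z) / 2) : ℝ) : ℂ) =
      Complex.exp (-(x / 2 * Complex.I)) ^ (2 * p) * P.eval (Complex.exp (x * Complex.I)) := by
    rw [Complex.ofReal_prod, Finset.prod_congr rfl fun z _ => hsin x z, Finset.prod_mul_distrib,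
      Finset.prod_const, hS, Polynomial.eval_prod]
    simp
  rw [h1, Polynomial.eval_eq_sum_range' hdeg, Finset.mul_sum]
  refine Finset.sum_congr rfl fun l _ => ?_
  rw [mul_left_comm, ← Complex.exp_nat_mul, ← Complex.exp_nat_mul, ← Complex.exp_add]
  push_cast
  ring_nf

/-- **Sturm–Hurwitz**: a function without frequencies below `k` has at least `2 k - 1` zeros
in every open interval of length `2π`. -/
lemma exists_finset_zeros_of_orthogonal {k : ℕ} (hk : 1 ≤ k) {h : ℝ → ℝ} (hc : Continuous h)
    (a : ℝ)
    (horth : ∀ j : ℤ, |j| ≤ (k : ℤ) - 1 →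
      (∫ x in a..(a + 2 * π), (h x : ℂ) * Complex.exp (-Complex.I * j * x)) = 0) :
    ∃ Z : Finset ℝ, Z.card = 2 * k - 1 ∧ ∀ x ∈ Z, x ∈ Set.Ioo a (a + 2 * π) ∧ h x = 0 := by
  refine exists_finset_of_zeros_card_le fun Z hZ => ?_
  by_contra! hcard
  have hpi := Real.pi_pos
  obtain ⟨S, hSZ, σ, hσ, hsign⟩ := exists_subset_sign_prod (s := fun y => Real.sin (y / 2))
    (a := a) (b := a + 2 * π)
    (fun y h1 h2 => Real.sin_pos_of_pos_of_lt_pi (by linarith) (by linarith))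
    (fun y h1 h2 => Real.sin_neg_of_neg_of_neg_pi_lt (by linarith) (by linarith))
    hc Z (a + 2 * π) le_rfl (fun x hx => (hZ x).mpr hx) (fun x hx hx0 => (hZ x).mp ⟨hx, hx0⟩)
  have haS : a ∉ S := fun hmem => lt_irrefl _ ((hZ a).mpr (hSZ hmem)).1.1
  have hsina : ∀ x ∈ Set.Ioo a (a + 2 * π), 0 < Real.sin ((x - a) / 2) := fun x hx =>
    Real.sin_pos_of_pos_of_lt_pi (by linarith [hx.1]) (by linarith [hx.2])
  have hScard := Finset.card_le_card hSZ
  obtain ⟨S', p, hS', hpk, hsub, hsign'⟩ : ∃ (S' : Finset ℝ) (p : ℕ), S'.card = 2 * p ∧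
      p + 1 ≤ k ∧ S' ⊆ insert a Z ∧
      ∀ x ∈ Set.Ioo a (a + 2 * π), 0 ≤ σ * h x * ∏ z ∈ S', Real.sin ((x - z) / 2) := by
    rcases Nat.even_or_odd' S.card with ⟨p, hp | hp⟩
    · exact ⟨S, p, hp, by omega, hSZ.trans (Finset.subset_insert a Z), hsign⟩
    · refine ⟨insert a S, p + 1, by rw [Finset.card_insert_of_notMem haS, hp]; ring, by omega,
        Finset.insert_subset_insert a hSZ, fun x hx => ?_⟩
      rw [Finset.prod_insert haS, mul_left_comm]
      exact mul_nonneg (hsina x hx).le (hsign x hx)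
  obtain ⟨c, hcsum⟩ := exists_prod_sin_eq_sum hS'
  set Q : ℝ → ℝ := fun x => ∏ z ∈ S', Real.sin ((x - z) / 2) with hQ
  have hQc : Continuous Q := by fun_prop
  have hint : ∫ x in a..(a + 2 * π), h x * Q x = 0 := by
    have h1 : ∫ x in a..(a + 2 * π), ((h x * Q x : ℝ) : ℂ) = 0 := by
      have h2 : ∀ x : ℝ, ((h x * Q x : ℝ) : ℂ) = ∑ l ∈ Finset.range (2 * p + 1),
          c l * ((h x : ℂ) * Complex.exp (-Complex.I * ((p : ℤ) - l : ℤ) * x)) := fun x => by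
        rw [Complex.ofReal_mul, hcsum x, Finset.mul_sum]
        exact Finset.sum_congr rfl fun l _ => by ring
      simp only [h2]
      rw [intervalIntegral.integral_finsetSum]
      · refine Finset.sum_eq_zero fun l hl => ?_
        rw [intervalIntegral.integral_const_mul, horth, mul_zero]
        have := Finset.mem_range.mp hl
        rw [abs_le]
        omega
      · exact fun l _ => Continuous.intervalIntegrable (by fun_prop) _ _
    rw [intervalIntegral.integral_ofReal] at h1
    exact_mod_cast h1
  obtain ⟨y, hy, hyZ⟩ : ∃ y ∈ Set.Ioo a (a + 2 * π), y ∉ Z := by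
    by_contra! hall
    exact (Set.Ioo_infinite (by linarith : a < a + 2 * π)) (Z.finite_toSet.subset hall)
  have hhy : h y ≠ 0 := fun h0 => hyZ ((hZ y).mp ⟨hy, h0⟩)
  have hQy : Q y ≠ 0 := by
    refine Finset.prod_ne_zero_iff.mpr fun z hz => ?_
    rcases Finset.mem_insert.mp (hsub hz) with rfl | hzZ
    · exact (hsina y hy).ne'
    · have hz' := ((hZ z).mpr hzZ).1
      have hyz : y ≠ z := fun h0 => hyZ (h0 ▸ hzZ)
      refine fun h0 => hyz ?_
      have := (Real.sin_eq_zero_iff_of_lt_of_lt (by linarith [hy.1, hz'.2])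
        (by linarith [hy.2, hz'.1])).mp h0
      linarith
  have hclosed : ∀ x ∈ Set.Icc a (a + 2 * π), 0 ≤ σ * h x * Q x := by
    have hcl : IsClosed {x | 0 ≤ σ * h x * Q x} :=
      isClosed_le continuous_const (by fun_prop)
    rw [← closure_Ioo (by linarith : a ≠ a + 2 * π)]
    exact hcl.closure_subset_iff.mpr hsign'
  have hpos : 0 < ∫ x in a..(a + 2 * π), σ * h x * Q x :=
    intervalIntegral.integral_pos (by linarith) (by fun_prop)
      (fun x hx => hclosed x ⟨hx.1.le, hx.2⟩)
      ⟨y, ⟨hy.1.le, hy.2.le⟩, lt_of_le_of_ne (hsign' y hy)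
        (mul_ne_zero (mul_ne_zero hσ hhy) hQy).symm⟩
  simp only [mul_assoc] at hpos
  rw [intervalIntegral.integral_const_mul, hint, mul_zero] at hpos
  exact lt_irrefl _ hpos

lemma eq_of_zeros_on_piece {k : ℕ} (hk : 1 ≤ k) {g : ℝ → ℝ} {q : ℝ} (hq : q < 1)
    (hg : ∀ u v, |g u - g v| ≤ q * |u - v|) {j : ℤ} {u v : ℝ}
    (hu : k * u ∈ Set.Icc (j * π) ((j + 1) * π)) (hv : k * v ∈ Set.Icc (j * π) ((j + 1) * π))
    (hu0 : tri (k * u) / k - g u = 0) (hv0 : tri (k * v) / k - g v = 0) : u = v := by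
  have hk0 : (0 : ℝ) < k := by exact_mod_cast hk
  have h1 : g u - g v = (tri (k * u) - tri (k * v)) / k := by
    rw [sub_div]; linarith
  have h2 : |g u - g v| = |u - v| := by
    rw [h1, abs_div, abs_tri_sub_eq hu hv, ← mul_sub, abs_mul, abs_of_pos hk0,
      mul_div_cancel_left₀ _ hk0.ne']
  have h3 := hg u v
  rw [h2] at h3
  have h4 : |u - v| = 0 := by nlinarith [abs_nonneg (u - v)]
  exact sub_eq_zero.mp (abs_eq_zero.mp h4)

lemma mem_piece_floor (y : ℝ) : y ∈ Set.Icc (⌊y / π⌋ * π) ((⌊y / π⌋ + 1) * π) :=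
  ⟨(le_div_iff₀ Real.pi_pos).mp (Int.floor_le _),
    ((div_lt_iff₀ Real.pi_pos).mp (Int.lt_floor_add_one _)).le⟩

lemma card_zeros_le {k : ℕ} (hk : 1 ≤ k) {g : ℝ → ℝ} {q : ℝ} (hq : q < 1)
    (hg : ∀ u v, |g u - g v| ≤ q * |u - v|) (hper : Function.Periodic g (2 * π)) {a : ℝ}
    {Z : Finset ℝ}
    (hZ : ∀ x ∈ Z, x ∈ Set.Ico a (a + 2 * π) ∧ tri (k * x) / k - g x = 0) :
    Z.card ≤ 2 * k := by
  have hpi := Real.pi_pos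
  have hkpos : (0 : ℤ) < 2 * k := by omega
  have htri : Function.Periodic tri (2 * π) := tri_antiperiodic.periodic_two_mul
  have hinj : Set.InjOn (fun x : ℝ => ⌊k * x / π⌋ % (2 * k : ℤ)) Z := by
    intro u hu v hv huv
    obtain ⟨n, hn⟩ : (2 * k : ℤ) ∣ ⌊k * v / π⌋ - ⌊k * u / π⌋ := Int.ModEq.dvd huv
    have hn' : ⌊k * v / π⌋ = ⌊k * u / π⌋ + 2 * k * n := by linarith
    have hshift : k * (u + n * (2 * π)) = k * u + (k * n : ℤ) * (2 * π) := by
      push_cast; ring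
    have hfl : ⌊k * (u + n * (2 * π)) / π⌋ = ⌊k * v / π⌋ := by
      rw [hn', ← Int.floor_add_intCast]
      congr 1
      push_cast
      field_simp
    have h0 : tri (k * (u + n * (2 * π))) / k - g (u + n * (2 * π)) = 0 := by
      rw [hshift, htri.int_mul (k * n) (k * u), hper.int_mul n u]
      exact (hZ u hu).2
    have heq := eq_of_zeros_on_piece hk hq hg (mem_piece_floor (k * (u + n * (2 * π))))
      (hfl ▸ mem_piece_floor (k * v)) h0 (hZ v hv).2
    have h1 := (hZ u hu).1
    have h2 := (hZ v hv).1
    have hn0 : n = 0 := by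
      have h3 : (n : ℝ) < 1 := by
        by_contra! hcon
        nlinarith [h1.1, h2.2]
      have h4 : (-1 : ℝ) < n := by
        by_contra! hcon
        nlinarith [h1.2, h2.1]
      have h5 : n < 1 := by exact_mod_cast h3
      have h6 : -1 < n := by exact_mod_cast h4
      omega
    simpa [hn0] using heq
  have := Finset.card_le_card_of_injOn (t := Finset.Ico (0 : ℤ) (2 * k)) _
    (fun x _ => Finset.mem_coe.mpr (Finset.mem_Ico.mpr
      ⟨Int.emod_nonneg _ hkpos.ne', Int.emod_lt_of_pos _ hkpos⟩)) hinj
  rw [Int.card_Ico] at this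
  omega

lemma card_zeros_le_of_zero {k : ℕ} (hk : 1 ≤ k) {g : ℝ → ℝ} {q : ℝ} (hq : q < 1)
    (hg : ∀ u v, |g u - g v| ≤ q * |u - v|) (hper : Function.Periodic g (2 * π))
    (h0 : tri (k * 0) / k - g 0 = 0) {Z : Finset ℝ}
    (hZ : ∀ x ∈ Z, x ∈ Set.Ioo 0 (2 * π) ∧ tri (k * x) / k - g x = 0) :
    Z.card ≤ 2 * k - 2 := by
  have hpi := Real.pi_pos
  have hk0 : (0 : ℝ) < k := by exact_mod_cast hk
  have htri : Function.Periodic tri (2 * π) := tri_antiperiodic.periodic_two_mul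
  have hend : tri (k * (2 * π)) / k - g (2 * π) = 0 := by
    have h1 := htri.nat_mul k 0
    have h2 := hper 0
    rw [zero_add] at h1 h2
    rw [h1, h2]
    simpa using h0
  have hinj : Set.InjOn (fun x : ℝ => ⌊k * x / π⌋) Z := fun u hu v hv huv =>
    eq_of_zeros_on_piece hk hq hg (mem_piece_floor (k * u))
      ((show ⌊k * u / π⌋ = ⌊k * v / π⌋ from huv) ▸ mem_piece_floor (k * v)) (hZ u hu).2 (hZ v hv).2
  have hmaps : ∀ x ∈ Z, ⌊k * x / π⌋ ∈ Finset.Ico (1 : ℤ) (2 * k - 1) := by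
    intro x hx
    obtain ⟨⟨hx1, hx2⟩, hx0⟩ := hZ x hx
    have hm := mem_piece_floor (k * x)
    have hnn : 0 ≤ ⌊k * x / π⌋ := Int.floor_nonneg.mpr (by positivity)
    have hlt : ⌊k * x / π⌋ < 2 * k := by
      refine Int.floor_lt.mpr ?_
      rw [div_lt_iff₀ hpi]
      push_cast
      nlinarith
    have hne0 : ⌊k * x / π⌋ ≠ 0 := fun h => by
      rw [h] at hm
      refine hx1.ne (eq_of_zeros_on_piece hk hq hg (j := 0) ?_ hm h0 hx0)
      simp [hpi.le]
    have hne1 : ⌊k * x / π⌋ ≠ 2 * k - 1 := fun h => by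
      rw [h] at hm
      refine hx2.ne (eq_of_zeros_on_piece hk hq hg hm ?_ hx0 hend)
      push_cast
      exact ⟨by nlinarith, by linarith⟩
    rw [Finset.mem_Ico]
    omega
  have := Finset.card_le_card_of_injOn _ hmaps hinj
  rw [Int.card_Ico] at this
  omega

lemma exists_abs_max {g : ℝ → ℝ} (hc : Continuous g) {T : ℝ} (hT : 0 < T)
    (hper : Function.Periodic g T) : ∃ x, ∀ y, |g y| ≤ |g x| := by
  obtain ⟨x, -, hx⟩ := isCompact_Icc.exists_isMaxOn (Set.nonempty_Icc.mpr hT.le)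
    (hc.abs.continuousOn (s := Set.Icc 0 T))
  refine ⟨x, fun y => ?_⟩
  obtain ⟨z, hz, hyz⟩ := hper.exists_mem_Ico₀ hT y
  rw [hyz]
  exact hx (Set.Ico_subset_Icc_self hz)

lemma iSup_abs_eq {g : ℝ → ℝ} {x : ℝ} (h : ∀ y, |g y| ≤ |g x|) : ⨆ y, |g y| = |g x| :=
  le_antisymm (ciSup_le h) (le_ciSup (f := fun y => |g y|) ⟨_, Set.forall_mem_range.mpr h⟩ x)

lemma abs_le_iSup_abs {g : ℝ → ℝ} (hc : Continuous g) {T : ℝ} (hT : 0 < T)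
    (hper : Function.Periodic g T) (y : ℝ) : |g y| ≤ ⨆ x, |g x| := by
  obtain ⟨x, hx⟩ := exists_abs_max hc hT hper
  rw [iSup_abs_eq hx]
  exact hx y

lemma eq_zero_of_hasDerivAt_of_abs_max {g : ℝ → ℝ} {g' x : ℝ} (hg : HasDerivAt g g' x)
    (h : ∀ y, |g y| ≤ |g x|) : g' = 0 := by
  refine IsLocalExtr.hasDerivAt_eq_zero ?_ hg
  rcases le_total 0 (g x) with h0 | h0
  · refine Or.inr (Filter.Eventually.of_forall fun y => ?_)
    have := h y
    rw [abs_of_nonneg h0] at this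
    exact (le_abs_self _).trans this
  · refine Or.inl (Filter.Eventually.of_forall fun y => ?_)
    have := h y
    rw [abs_of_nonpos h0] at this
    have := neg_abs_le (g y)
    show g x ≤ g y
    linarith

lemma hasDerivAt_of_eq_integral {F G : ℝ → ℝ} (hF : Continuous F)
    (hG : ∀ x, G x = G 0 + ∫ t in (0 : ℝ)..x, F t) (x : ℝ) : HasDerivAt G (F x) x := by
  rw [show G = fun x => G 0 + ∫ t in (0 : ℝ)..x, F t from funext hG]
  exact (hF.integral_hasStrictDerivAt 0 x).hasDerivAt.const_add _

lemma antiperiodic_of_hasDerivAt {k : ℕ} (hk : 1 ≤ k) {F G : ℝ → ℝ}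
    (hF : Function.Antiperiodic F (π / k)) (hG : ∀ x, HasDerivAt G (F x) x)
    (hmean : ∫ x in (0 : ℝ)..(2 * π), G x = 0) : Function.Antiperiodic G (π / k) := by
  have hk0 : (k : ℝ) ≠ 0 := by positivity
  have hGc : Continuous G := continuous_iff_continuousAt.mpr fun x => (hG x).continuousAt
  have hconst : ∀ x, G (x + π / k) + G x = G (0 + π / k) + G 0 := by
    have hd : ∀ x, HasDerivAt (fun x => G (x + π / k) + G x) 0 x := fun x => by
      have := ((hG (x + π / k)).comp_add_const x (π / k)).add (hG x)
      rwa [hF x, neg_add_cancel] at this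
    exact fun x => is_const_of_deriv_eq_zero (fun x => (hd x).differentiableAt)
      (fun x => (hd x).deriv) x 0
  set K := G (0 + π / k) + G 0
  have hper : Function.Periodic G (2 * π) := by
    have h2 : Function.Periodic G (2 * (π / k)) := fun x => by
      have h3 := hconst x
      have h4 := hconst (x + π / k)
      rw [two_mul, ← add_assoc]
      linarith
    have h3 := h2.nat_mul k
    rwa [show (k : ℝ) * (2 * (π / k)) = 2 * π by field_simp] at h3
  have hint : ∫ x in (0 : ℝ)..(2 * π), G (x + π / k) = 0 := by
    rw [intervalIntegral.integral_comp_add_right, zero_add, add_comm (2 * π),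
      hper.intervalIntegral_add_eq (π / k) 0, zero_add, hmean]
  have hK : ∫ x in (0 : ℝ)..(2 * π), (G (x + π / k) + G x) = 0 := by
    rw [intervalIntegral.integral_add (Continuous.intervalIntegrable (by fun_prop) _ _)
      (hGc.intervalIntegrable _ _), hint, hmean, add_zero]
  simp only [hconst, intervalIntegral.integral_const, sub_zero, smul_eq_mul, mul_eq_zero,
    Real.two_pi_pos.ne', false_or] at hK
  intro x
  have := hconst x
  linarith

lemma periodic_two_pi_of_antiperiodic {k : ℕ} (hk : 1 ≤ k) {G : ℝ → ℝ}
    (hG : Function.Antiperiodic G (π / k)) : Function.Periodic G (2 * π) := by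
  have h := hG.periodic_two_mul.nat_mul k
  have hk0 : (k : ℝ) ≠ 0 := by positivity
  rwa [show (k : ℝ) * (2 * (π / k)) = 2 * π by field_simp] at h

lemma periodic_mul_exp {f : ℝ → ℝ} (hf : Function.Periodic f (2 * π)) (j : ℤ) :
    Function.Periodic (fun x : ℝ => (f x : ℂ) * Complex.exp (-Complex.I * j * x)) (2 * π) := by
  intro x
  simp only [hf x]
  congr 1
  rw [Complex.exp_eq_exp_iff_exists_int]
  exact ⟨-j, by push_cast; ring⟩

/-- Translating a periodic function multiplies its Fourier coefficients by a phase. -/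
lemma integral_comp_add_mul_exp {f : ℝ → ℝ} (hf : Function.Periodic f (2 * π)) (j : ℤ)
    (a s : ℝ) :
    ∫ x in a..(a + 2 * π), (f (x + s) : ℂ) * Complex.exp (-Complex.I * j * x) =
      Complex.exp (Complex.I * j * s) *
        ∫ x in (0 : ℝ)..(2 * π), (f x : ℂ) * Complex.exp (-Complex.I * j * x) := by
  have h1 : ∀ x : ℝ, (f (x + s) : ℂ) * Complex.exp (-Complex.I * j * x) =
      Complex.exp (Complex.I * j * s) *
        ((f (x + s) : ℂ) * Complex.exp (-Complex.I * j * (x + s : ℝ))) := fun x => by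
    rw [mul_left_comm, ← Complex.exp_add]
    push_cast
    ring_nf
  simp only [h1]
  rw [intervalIntegral.integral_const_mul, intervalIntegral.integral_comp_add_right
    (fun x : ℝ => (f x : ℂ) * Complex.exp (-Complex.I * j * x)),
    add_right_comm, (periodic_mul_exp hf j).intervalIntegral_add_eq (a + s) 0, zero_add]

lemma integral_mul_exp_eq_zero_of_antiperiodic {k : ℕ} (hk : 1 ≤ k) {G : ℝ → ℝ}
    (hG : Function.Antiperiodic G (π / k)) {j : ℤ} (hj : |j| ≤ (k : ℤ) - 1) :
    ∫ x in (0 : ℝ)..(2 * π), (G x : ℂ) * Complex.exp (-Complex.I * j * x) = 0 := by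
  have hk0 : (k : ℂ) ≠ 0 := by exact_mod_cast (by omega : k ≠ 0)
  have h := integral_comp_add_mul_exp (periodic_two_pi_of_antiperiodic hk hG) j 0 (π / k)
  simp only [hG _, Complex.ofReal_neg, neg_mul, zero_add] at h
  rw [intervalIntegral.integral_neg] at h
  set A := ∫ x in (0 : ℝ)..(2 * π), (G x : ℂ) * Complex.exp (-(Complex.I * j * x))
  simp only [neg_mul]
  by_contra hA
  have h1 : Complex.exp (Complex.I * j * (π / k : ℝ)) = -1 := by
    have : (Complex.exp (Complex.I * j * (π / k : ℝ)) + 1) * A = 0 := by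
      linear_combination -h
    exact eq_neg_of_add_eq_zero_left ((mul_eq_zero.mp this).resolve_right hA)
  rw [← Complex.exp_pi_mul_I, Complex.exp_eq_exp_iff_exists_int] at h1
  obtain ⟨n, hn⟩ := h1
  have hpi : (π : ℂ) ≠ 0 := by exact_mod_cast Real.pi_ne_zero
  have h2 : (j : ℂ) = k * (1 + 2 * n) := by
    have h3 : (π * Complex.I) * ((j : ℂ) / k) = (π * Complex.I) * (1 + 2 * n) := by
      push_cast at hn
      linear_combination hn
    have h4 := mul_left_cancel₀ (mul_ne_zero hpi Complex.I_ne_zero) h3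
    field_simp at h4
    linear_combination h4
  have h3 : j = k * (1 + 2 * n) := by exact_mod_cast h2
  have h4 : 1 ≤ |1 + 2 * n| := Int.one_le_abs (by omega)
  have h5 : |j| = k * |1 + 2 * n| := by rw [h3, abs_mul]; simp
  nlinarith

/-- If `H 0` has no frequencies below `k` and its `d`-th derivative `H d` differs from the
triangular cosine by a strict contraction, then `H 0` has no double zero (and, for `d = 0`,
does not vanish at the peak of the triangular cosine). -/
lemma false_of_double_zero {k : ℕ} (hk : 1 ≤ k) {d : ℕ} {H : ℕ → ℝ → ℝ}
    (hcont : Continuous (H 0)) (hder : ∀ n < d, ∀ x, HasDerivAt (H n) (H (n + 1) x) x)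
    (hper : ∀ n, n ≤ d → Function.Periodic (H n) (2 * π)) {x₁ : ℝ}
    (horth : ∀ j : ℤ, |j| ≤ (k : ℤ) - 1 →
      (∫ x in x₁..(x₁ + 2 * π), (H 0 x : ℂ) * Complex.exp (-Complex.I * j * x)) = 0)
    {g : ℝ → ℝ} {q : ℝ} (hq : q < 1) (hg : ∀ u v, |g u - g v| ≤ q * |u - v|)
    (hgper : Function.Periodic g (2 * π)) (hH : ∀ x, H d x = tri (k * x) / k - g x)
    (h0 : H 0 x₁ = 0) (hpeak : d = 0 → x₁ = 0) (hdouble : 0 < d → H 1 x₁ = 0) : False := by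
  have hpi := Real.pi_pos
  obtain ⟨Z, hZcard, hZ⟩ := exists_finset_zeros_of_orthogonal hk hcont x₁ horth
  rcases Nat.eq_zero_or_pos d with rfl | hd
  · obtain rfl := hpeak rfl
    have := card_zeros_le_of_zero hk hq hg hgper ((hH 0).symm.trans h0) (Z := Z) fun x hx =>
      ⟨by simpa using (hZ x hx).1, (hH x).symm.trans (hZ x hx).2⟩
    omega
  · have h1 : x₁ ∉ Z := fun h => lt_irrefl _ (hZ _ h).1.1
    have h2 : x₁ + 2 * π ∉ insert x₁ Z := fun h => by
      rcases Finset.mem_insert.mp h with h | h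
      · linarith
      · exact lt_irrefl _ (hZ _ h).1.2
    obtain ⟨W, hWcard, hW⟩ := exists_finset_zeros_deriv (hder 0 hd) (a := x₁) (b := x₁ + 2 * π)
      (Z := insert (x₁ + 2 * π) (insert x₁ Z)) (n := 2 * k) (by
        intro x hx
        rcases Finset.mem_insert.mp hx with rfl | hx
        · exact ⟨⟨by linarith, le_rfl⟩, (hper 0 hd.le x₁).trans h0⟩
        rcases Finset.mem_insert.mp hx with rfl | hx
        · exact ⟨⟨le_rfl, by linarith⟩, h0⟩
        · exact ⟨Set.Ioo_subset_Icc_self (hZ x hx).1, (hZ x hx).2⟩)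
      (by rw [Finset.card_insert_of_notMem h2, Finset.card_insert_of_notMem h1]; omega)
    have h3 : x₁ ∉ W := fun h => lt_irrefl _ (hW _ h).1.1
    have hmany : ∀ n, n + 1 ≤ d → ∃ a, ∃ Z : Finset ℝ, Z.card = 2 * k + 1 ∧
        ∀ x ∈ Z, x ∈ Set.Ico a (a + 2 * π) ∧ H (n + 1) x = 0 := by
      intro n
      induction n with
      | zero =>
        refine fun _ => ⟨x₁, insert x₁ W, by rw [Finset.card_insert_of_notMem h3, hWcard],
          fun x hx => ?_⟩
        rcases Finset.mem_insert.mp hx with rfl | hx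
        · exact ⟨⟨le_rfl, by linarith⟩, hdouble hd⟩
        · exact ⟨Set.Ioo_subset_Ico_self (hW x hx).1, (hW x hx).2⟩
      | succ n ih =>
        exact fun hn => exists_finset_zeros_deriv_of_periodic (hder (n + 1) hn)
          Real.two_pi_pos (hper (n + 1) (by omega)) (ih (by omega))
    obtain ⟨a, V, hVcard, hV⟩ := hmany (d - 1) (by omega)
    rw [Nat.sub_add_cancel hd] at hV
    have := card_zeros_le hk hq hg hgper fun x hx =>
      ⟨(hV x hx).1, (hH x).symm.trans (hV x hx).2⟩
    omega

lemma periodic_iteratedDeriv {f : ℝ → ℝ} {T : ℝ} (hf : Function.Periodic f T) (n : ℕ) :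
    Function.Periodic (iteratedDeriv n f) T := by
  intro x
  have h := congrFun (iteratedDeriv_comp_add_const n f T) x
  rw [show (fun z => f (z + T)) = f from funext hf] at h
  exact h.symm

lemma hasDerivAt_iteratedDeriv {f : ℝ → ℝ} {m : ℕ} (hf : ContDiff ℝ (m : ℕ∞) f) {n : ℕ}
    (hn : n < m) (x : ℝ) :
    HasDerivAt (iteratedDeriv n f) (iteratedDeriv (n + 1) f x) x := by
  rw [iteratedDeriv_succ]
  exact ((hf.differentiable_iteratedDeriv n (by exact_mod_cast hn)) x).hasDerivAt

/-- The Bohr–Favard inequality, in terms of an iterated primitive `Φ d` of the triangular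
cosine and a point `x₁` where it attains its maximal modulus. -/
lemma abs_mul_iSup_le {k d : ℕ} (hk : 1 ≤ k) {Φ : ℕ → ℝ → ℝ}
    (hΦ0 : ∀ x, Φ 0 x = tri (k * x) / k) (hΦc : ∀ n, Continuous (Φ n))
    (hΦ : ∀ n x, HasDerivAt (Φ (n + 1)) (Φ n x) x)
    (hanti : ∀ n, Function.Antiperiodic (Φ n) (π / k)) {x₁ : ℝ}
    (hx₁ : ∀ y, |Φ d y| ≤ |Φ d x₁|) (hpeak : d = 0 → x₁ = 0) {f : ℝ → ℝ}
    (hper : Function.Periodic f (2 * π)) (hf : ContDiff ℝ ((d + 1 : ℕ) : ℕ∞) f)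
    (horth : ∀ j : ℤ, |j| ≤ (k : ℤ) - 1 →
      (∫ x in (0:ℝ)..(2 * π), (f x : ℂ) * Complex.exp (-Complex.I * j * x)) = 0) :
    ⨆ x, |f x| ≤ |Φ d x₁| * ⨆ x, |iteratedDeriv (d + 1) f x| := by
  obtain ⟨x₀, hx₀⟩ := exists_abs_max hf.continuous Real.two_pi_pos hper
  rw [iSup_abs_eq hx₀]
  set N := ⨆ x, |iteratedDeriv (d + 1) f x|
  have hN : ∀ x, |iteratedDeriv (d + 1) f x| ≤ N :=
    abs_le_iSup_abs (hf.continuous_iteratedDeriv _ le_rfl) Real.two_pi_pos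
      (periodic_iteratedDeriv hper _)
  have hN0 : 0 ≤ N := (abs_nonneg _).trans (hN 0)
  by_contra! hlt
  have hf0 : 0 < |f x₀| := (by positivity : 0 ≤ |Φ d x₁| * N).trans_lt hlt
  set μ := Φ d x₁ / f x₀ with hμ
  set s := x₀ - x₁ with hs
  have hμf : μ * f x₀ = Φ d x₁ := div_mul_cancel₀ _ (abs_pos.mp hf0)
  have hq : |μ| * N < 1 := by
    rw [hμ, abs_div, div_mul_eq_mul_div, div_lt_one hf0]
    exact hlt
  have hfd : ∀ n < d + 1, ∀ x, HasDerivAt (fun x => μ * iteratedDeriv n f (x + s))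
      (μ * iteratedDeriv (n + 1) f (x + s)) x := fun n hn x =>
    ((hasDerivAt_iteratedDeriv hf hn (x + s)).comp_add_const x s).const_mul μ
  have hfper : ∀ n, Function.Periodic (fun x => μ * iteratedDeriv n f (x + s)) (2 * π) :=
    fun n x => by
      simp only [add_right_comm x (2 * π) s, periodic_iteratedDeriv hper n (x + s)]
  have hHd : ∀ n < d, ∀ x,
      HasDerivAt (fun x => Φ (d - n) x - μ * iteratedDeriv n f (x + s))
        (Φ (d - (n + 1)) x - μ * iteratedDeriv (n + 1) f (x + s)) x := fun n hn x => by
    have h := hΦ (d - (n + 1)) x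
    rw [show d - (n + 1) + 1 = d - n by omega] at h
    exact h.sub (hfd n (by omega) x)
  have hfc := hf.continuous
  refine false_of_double_zero hk (d := d) (x₁ := x₁)
    (H := fun n x => Φ (d - n) x - μ * iteratedDeriv n f (x + s))
    (g := fun x => μ * iteratedDeriv d f (x + s)) (q := |μ| * N)
    ?_ hHd ?_ ?_ hq ?_ (hfper d) ?_ ?_ hpeak ?_
  · simp only [iteratedDeriv_zero]
    exact (hΦc _).sub (by fun_prop)
  · exact fun n _ => (periodic_two_pi_of_antiperiodic hk (hanti _)).sub (hfper n)
  · intro j hj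
    have h1 := integral_comp_add_mul_exp hper j x₁ s
    rw [horth j hj, mul_zero] at h1
    have h2 := integral_comp_add_mul_exp (periodic_two_pi_of_antiperiodic hk (hanti d)) j x₁ 0
    rw [integral_mul_exp_eq_zero_of_antiperiodic hk (hanti d) hj, mul_zero] at h2
    have h3 : ∀ x : ℝ, ((Φ (d - 0) x - μ * iteratedDeriv 0 f (x + s) : ℝ) : ℂ) *
        Complex.exp (-Complex.I * j * x) =
        (Φ d (x + 0) : ℂ) * Complex.exp (-Complex.I * j * x) -
          μ * ((f (x + s) : ℂ) * Complex.exp (-Complex.I * j * x)) := fun x => by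
      simp only [iteratedDeriv_zero, Nat.sub_zero, add_zero]
      push_cast
      ring
    have hΦd := hΦc d
    simp only [h3]
    rw [intervalIntegral.integral_sub (Continuous.intervalIntegrable (by fun_prop) _ _)
      (Continuous.intervalIntegrable (by fun_prop) _ _), intervalIntegral.integral_const_mul,
      h1, h2, mul_zero, sub_zero]
  · intro u v
    have := Convex.norm_image_sub_le_of_norm_hasDerivWithin_le (C := |μ| * N)
      (fun x _ => (hfd d (Nat.lt_succ_self d) x).hasDerivWithinAt (s := Set.univ))
      (fun x _ => by
        rw [norm_mul, Real.norm_eq_abs, Real.norm_eq_abs]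
        exact mul_le_mul_of_nonneg_left (hN _) (abs_nonneg μ))
      convex_univ (Set.mem_univ v) (Set.mem_univ u)
    simpa only [Real.norm_eq_abs] using this
  · intro x
    simp only [Nat.sub_self, hΦ0]
  · simp [hs, hμf]
  · intro hd
    have h1 : Φ (d - 1) x₁ = 0 := by
      have h := hΦ (d - 1) x₁
      rw [Nat.sub_add_cancel hd] at h
      exact eq_zero_of_hasDerivAt_of_abs_max h hx₁
    have h2 : iteratedDeriv 1 f x₀ = 0 := by
      have h := hasDerivAt_iteratedDeriv hf (Nat.succ_pos d) x₀
      rw [iteratedDeriv_zero] at h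
      exact eq_zero_of_hasDerivAt_of_abs_max h hx₀
    simp [h1, hs, h2]

/-- Difference quotients of the next primitive show that no larger constant is possible. -/
lemma mul_abs_le_one_of_forall {k d : ℕ} (hk : 1 ≤ k) {Φ : ℕ → ℝ → ℝ}
    (hΦ0 : ∀ x, Φ 0 x = tri (k * x) / k) (hΦc : ∀ n, Continuous (Φ n))
    (hΦ : ∀ n x, HasDerivAt (Φ (n + 1)) (Φ n x) x)
    (hanti : ∀ n, Function.Antiperiodic (Φ n) (π / k)) {C : ℝ} (hC0 : 0 ≤ C)
    (hC : ∀ f : ℝ → ℝ, Function.Periodic f (2 * π) → ContDiff ℝ ((d + 1 : ℕ) : ℕ∞) f →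
      (∀ j : ℤ, |j| ≤ (k : ℤ) - 1 →
        (∫ x in (0:ℝ)..(2 * π), (f x : ℂ) * Complex.exp (-Complex.I * j * x)) = 0) →
      C * (⨆ x : ℝ, |f x|) ≤ ⨆ x : ℝ, |iteratedDeriv (d + 1) f x|) (x₁ : ℝ) :
    C * |Φ d x₁| ≤ 1 := by
  have hk0 : (0 : ℝ) < k := by exact_mod_cast hk
  have hderiv : ∀ n, deriv (Φ (n + 1)) = Φ n := fun n => funext fun x => (hΦ n x).deriv
  have hsmooth : ∀ n : ℕ, ContDiff ℝ n (Φ n) := by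
    intro n
    induction n with
    | zero => exact contDiff_zero.mpr (hΦc 0)
    | succ n ih =>
      push_cast
      refine contDiff_succ_iff_deriv.mpr ⟨fun x => (hΦ n x).differentiableAt, by simp, ?_⟩
      rwa [hderiv]
  have hiter : ∀ n, iteratedDeriv n (Φ n) = Φ 0 := by
    intro n
    induction n with
    | zero => exact iteratedDeriv_zero
    | succ n ih => rw [iteratedDeriv_succ', hderiv, ih]
  have hstep : ∀ ε : ℝ, 0 < ε → C * |ε⁻¹ * (Φ (d + 1) (x₁ + ε) - Φ (d + 1) x₁)| ≤ 1 := by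
    intro ε hε
    have hper := periodic_two_pi_of_antiperiodic hk (hanti (d + 1))
    let F : ℝ → ℝ := fun x => ε⁻¹ * (Φ (d + 1) (x + ε) - Φ (d + 1) x)
    have hFanti : Function.Antiperiodic F (π / k) := fun x => by
      simp only [F, add_right_comm x (π / k) ε, hanti (d + 1) _]
      ring
    have hFper := periodic_two_pi_of_antiperiodic hk hFanti
    have hsm : ContDiff ℝ ((d + 1 : ℕ) : ℕ∞) (Φ (d + 1)) := by exact_mod_cast hsmooth (d + 1)
    have hsm' : ContDiff ℝ ((d + 1 : ℕ) : ℕ∞) fun x => Φ (d + 1) (x + ε) :=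
      hsm.comp (contDiff_id.add contDiff_const)
    have hFsm : ContDiff ℝ ((d + 1 : ℕ) : ℕ∞) F := contDiff_const.mul (hsm'.sub hsm)
    have hFd : ∀ x, iteratedDeriv (d + 1) F x = ε⁻¹ * (Φ 0 (x + ε) - Φ 0 x) := fun x => by
      have h1 : iteratedDeriv (d + 1) (fun x => Φ (d + 1) (x + ε)) x = Φ 0 (x + ε) := by
        rw [iteratedDeriv_comp_add_const, hiter]
      simp only [F]
      rw [iteratedDeriv_const_mul_field, iteratedDeriv_fun_sub hsm'.contDiffAt hsm.contDiffAt,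
        h1, hiter]
    have hFle : ⨆ x, |iteratedDeriv (d + 1) F x| ≤ 1 := by
      refine ciSup_le fun x => ?_
      rw [hFd, hΦ0, hΦ0, abs_mul, ← sub_div, abs_div, abs_of_pos (inv_pos.mpr hε),
        abs_of_pos hk0, inv_mul_le_iff₀ hε, mul_one, div_le_iff₀ hk0]
      refine (abs_tri_sub_le _ _).trans (le_of_eq ?_)
      rw [← mul_sub, add_sub_cancel_left, abs_of_pos (by positivity), mul_comm]
    exact (mul_le_mul_of_nonneg_left (abs_le_iSup_abs hFsm.continuous Real.two_pi_pos hFper x₁)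
      hC0).trans ((hC F hFper hFsm fun j hj =>
        integral_mul_exp_eq_zero_of_antiperiodic hk hFanti hj).trans hFle)
  have hlim := (hasDerivAt_iff_tendsto_slope_zero.mp (hΦ d x₁)).mono_left
    (nhdsWithin_mono (0 : ℝ) (fun y (hy : 0 < y) => (ne_of_gt hy : y ≠ 0)) :
      nhdsWithin (0 : ℝ) (Set.Ioi 0) ≤ _)
  refine le_of_tendsto (hlim.abs.const_mul C) ?_
  filter_upwards [self_mem_nhdsWithin] with ε hε
  exact hstep ε hε

/-- **Reverse Bernstein inequality, general order, with optimal constant.**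
Let `Ck n` be the n-fold zero-mean primitive of `c_k(x) = c(kx)/k`.  Every
2π-periodic `C^m` function `f` whose Fourier coefficients vanish for `|j| ≤ k−1`
satisfies `‖f^{(m)}‖_∞ ≥ C_{k,m}·‖f‖_∞` with `C_{k,m} = 1/‖I^{m−1}c_k‖_∞`, and
this constant is optimal. -/
theorem reverse_bernstein_general
    (k m : ℕ) (hk : 1 ≤ k) (hm : 1 ≤ m)
    (Ck : ℕ → ℝ → ℝ)
    (hCk0 : Ck 0 = fun x => tri (k * x) / k)
    (hCkrec : ∀ n, ∀ x : ℝ, Ck (n + 1) x = Ck (n + 1) 0 + ∫ t in (0:ℝ)..x, Ck n t)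
    (hCkmean : ∀ n, (∫ x in (0:ℝ)..(2 * π), Ck (n + 1) x) = 0) :
    (∀ f : ℝ → ℝ, Function.Periodic f (2 * π) → ContDiff ℝ (m : ℕ∞) f →
      (∀ j : ℤ, |j| ≤ (k : ℤ) - 1 →
        (∫ x in (0:ℝ)..(2 * π), (f x : ℂ) * Complex.exp (-Complex.I * j * x)) = 0) →
      (1 / (⨆ x : ℝ, |Ck (m - 1) x|)) * (⨆ x : ℝ, |f x|) ≤
        ⨆ x : ℝ, |iteratedDeriv m f x|) ∧
    (∀ C : ℝ,
      (∀ f : ℝ → ℝ, Function.Periodic f (2 * π) → ContDiff ℝ (m : ℕ∞) f →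
        (∀ j : ℤ, |j| ≤ (k : ℤ) - 1 →
          (∫ x in (0:ℝ)..(2 * π), (f x : ℂ) * Complex.exp (-Complex.I * j * x)) = 0) →
        C * (⨆ x : ℝ, |f x|) ≤ ⨆ x : ℝ, |iteratedDeriv m f x|) →
      C ≤ 1 / (⨆ x : ℝ, |Ck (m - 1) x|)) := by
  obtain ⟨d, rfl⟩ : ∃ d, m = d + 1 := ⟨m - 1, by omega⟩
  rw [Nat.add_sub_cancel]
  have hk0 : (0 : ℝ) < k := by exact_mod_cast hk
  have hCk0' : ∀ x, Ck 0 x = tri (k * x) / k := fun x => by rw [hCk0]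
  have hcont : ∀ n, Continuous (Ck n) := by
    intro n
    induction n with
    | zero =>
      rw [hCk0]
      exact (continuous_tri.comp (continuous_const.mul continuous_id)).div_const _
    | succ n ih =>
      exact continuous_iff_continuousAt.mpr fun x =>
        (hasDerivAt_of_eq_integral ih (hCkrec n) x).continuousAt
  have hder : ∀ n x, HasDerivAt (Ck (n + 1)) (Ck n x) x := fun n =>
    hasDerivAt_of_eq_integral (hcont n) (hCkrec n)
  have hanti : ∀ n, Function.Antiperiodic (Ck n) (π / k) := by
    intro n
    induction n with
    | zero =>
      intro x
      rw [hCk0', hCk0', mul_add, mul_div_cancel₀ _ hk0.ne', tri_antiperiodic, neg_div]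
    | succ n ih => exact antiperiodic_of_hasDerivAt hk ih (hder n) (hCkmean n)
  obtain ⟨x₁, hx₁, hpeak⟩ : ∃ x₁, (∀ y, |Ck d y| ≤ |Ck d x₁|) ∧ (d = 0 → x₁ = 0) := by
    rcases Nat.eq_zero_or_pos d with rfl | hd
    · refine ⟨0, fun y => ?_, fun _ => rfl⟩
      rw [hCk0', hCk0', abs_div, abs_div, mul_zero, tri_zero,
        abs_of_pos (by positivity : 0 < π / 2)]
      gcongr
      exact abs_tri_le _
    · obtain ⟨x₁, hx₁⟩ := exists_abs_max (hcont d) Real.two_pi_pos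
        (periodic_two_pi_of_antiperiodic hk (hanti d))
      exact ⟨x₁, hx₁, fun h => absurd h hd.ne'⟩
  have hpos : 0 < |Ck d x₁| := by
    by_contra! hle
    have hzero : ∀ n, (∀ y, Ck n y = 0) → False := by
      intro n
      induction n with
      | zero =>
        intro h
        have h1 := h 0
        rw [hCk0', mul_zero, tri_zero] at h1
        exact (by positivity : π / 2 / (k : ℝ) ≠ 0) h1
      | succ n ih =>
        refine fun h => ih fun y => ?_
        rw [← (hder n y).deriv, show Ck (n + 1) = fun _ => 0 from funext h, deriv_const]
    exact hzero d fun y => abs_nonpos_iff.mp ((hx₁ y).trans hle)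
  rw [iSup_abs_eq hx₁]
  refine ⟨fun f hper hf horth => ?_, fun C hC => ?_⟩
  · rw [one_div, inv_mul_le_iff₀ hpos]
    exact abs_mul_iSup_le hk hCk0' hcont hder hanti hx₁ hpeak hper hf horth
  · rw [le_div_iff₀ hpos]
    rcases le_total 0 C with hC0 | hC0
    · exact mul_abs_le_one_of_forall hk hCk0' hcont hder hanti hC0 hC x₁
    · exact (mul_nonpos_of_nonpos_of_nonneg hC0 hpos.le).trans zero_le_one
end
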